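/- arXiv:1101.3300 — 8 statements merged into one kernel-verified Lean document; each statement's English description precedes it below -/
import Mathlib

section
/- Let R be a commutative ring and let F be a functor from commutative R-algebras to sets that preserves filtered colimits. Let A be a commutative R-algebra and let (B_i)_{i∈I} be a filtered direct system of commutative A-algebras with colimit B = colim_i B_i. Suppose that for every i ∈ I the diagram F(A) → F(B_i) ⇉ F(B_i ⊗_A B_i) is an equalizer, where the two parallel maps are induced by the A-algebra maps b ↦ b ⊗ 1 and b ↦ 1 ⊗ b. Then the diagram F(A) → F(B) ⇉ F(B ⊗_A B) is an equalizer. -/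
/-!
STATEMENT 0: Let R be a commutative ring and let F be a functor from commutative R-algebras
to sets preserving filtered colimits.  Let A be a commutative R-algebra and (B_i) a filtered
system of commutative A-algebras with colimit B.  If for every i the diagram
F(A) → F(B_i) ⇉ F(B_i ⊗_A B_i) is an equalizer, then F(A) → F(B) ⇉ F(B ⊗_A B) is an equalizer.

Commutative R-algebras are encoded as the category `Under (R : CommRingCat)`;
the tensor product B ⊗_A B is the pushout of the structure map with itself, and the two
parallel maps are induced by `pushout.inl` (b ↦ b ⊗ 1) and `pushout.inr` (b ↦ 1 ⊗ b).
-/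

open CategoryTheory CategoryTheory.Limits

universe u

namespace Stmt0

variable (R : CommRingCat.{u}) (A : Under R)

/-- An `A`-algebra, regarded as an `R`-algebra. -/
noncomputable def objOf (x : Under A.right) : Under R :=
  Under.mk (A.hom ≫ x.hom)

/-- `B_i ⊗_A B_i`, regarded as an `R`-algebra. -/
noncomputable def tensorObj (x : Under A.right) : Under R :=
  Under.mk (A.hom ≫ x.hom ≫ pushout.inl x.hom x.hom)

/-- The structure morphism `A → B_i` of `R`-algebras. -/
noncomputable def structMor (x : Under A.right) : A ⟶ objOf R A x :=
  Under.homMk x.hom rfl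

/-- The map `b ↦ b ⊗ 1 : B_i → B_i ⊗_A B_i` of `R`-algebras. -/
noncomputable def inlMor (x : Under A.right) : objOf R A x ⟶ tensorObj R A x :=
  Under.homMk (pushout.inl x.hom x.hom) (by simp [objOf, tensorObj])

/-- The map `b ↦ 1 ⊗ b : B_i → B_i ⊗_A B_i` of `R`-algebras. -/
noncomputable def inrMor (x : Under A.right) : objOf R A x ⟶ tensorObj R A x :=
  Under.homMk (pushout.inr x.hom x.hom)
    (by simp [objOf, tensorObj, pushout.condition])

/-- `F(A') → F(X) ⇉ F(T)` is an equalizer diagram of sets: the first map is injective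
and its image is exactly the set on which the two parallel maps agree. -/
def IsEqualizerDiagram (F : Under R ⥤ Type u) {A' X T : Under R}
    (e : A' ⟶ X) (p q : X ⟶ T) : Prop :=
  Function.Injective (F.map e) ∧
    Set.range (F.map e) = {x : F.obj X | F.map p x = F.map q x}

end Stmt0

namespace Stmt0

variable {R : CommRingCat.{u}} (A : Under R)

/-- Restriction of scalars from `A`-algebras to `R`-algebras. -/
noncomputable def objFunctor : Under A.right ⥤ Under R where
  obj x := objOf R A x
  map f := Under.homMk f.right (by simp [objOf])
  map_id _ := rfl
  map_comp _ _ := rfl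

/-- The ring homomorphism `B ⊗_A B ⟶ C ⊗_A C` induced by a map `B ⟶ C` of `A`-algebras. -/
noncomputable def tensorMap {X : CommRingCat.{u}} {x y : Under X} (f : x ⟶ y) :
    pushout x.hom x.hom ⟶ pushout y.hom y.hom :=
  pushout.desc (f.right ≫ pushout.inl _ _) (f.right ≫ pushout.inr _ _) <| by
    rw [Under.w_assoc, Under.w_assoc, pushout.condition]

lemma inl_tensorMap {X : CommRingCat.{u}} {x y : Under X} (f : x ⟶ y) :
    pushout.inl x.hom x.hom ≫ tensorMap f = f.right ≫ pushout.inl y.hom y.hom :=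
  pushout.inl_desc _ _ _

lemma inr_tensorMap {X : CommRingCat.{u}} {x y : Under X} (f : x ⟶ y) :
    pushout.inr x.hom x.hom ≫ tensorMap f = f.right ≫ pushout.inr y.hom y.hom :=
  pushout.inr_desc _ _ _

lemma tensorMap_id {X : CommRingCat.{u}} (x : Under X) : tensorMap (𝟙 x) = 𝟙 _ := by
  apply pushout.hom_ext <;> simp [inl_tensorMap, inr_tensorMap]

lemma tensorMap_comp {X : CommRingCat.{u}} {x y z : Under X} (f : x ⟶ y) (g : y ⟶ z) :
    tensorMap (f ≫ g) = tensorMap f ≫ tensorMap g := by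
  apply pushout.hom_ext
  · rw [inl_tensorMap, ← Category.assoc, inl_tensorMap, Category.assoc, inl_tensorMap,
      Under.comp_right, Category.assoc]
  · rw [inr_tensorMap, ← Category.assoc, inr_tensorMap, Category.assoc, inr_tensorMap,
      Under.comp_right, Category.assoc]

/-- The functor `B ↦ B ⊗_A B` from `A`-algebras to `R`-algebras. -/
noncomputable def tensorFunctor : Under A.right ⥤ Under R where
  obj x := tensorObj R A x
  map {x y} f := Under.homMk (tensorMap f) <| by
    change (A.hom ≫ x.hom ≫ pushout.inl x.hom x.hom) ≫ tensorMap f = A.hom ≫ y.hom ≫ _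
    rw [Category.assoc, Category.assoc, inl_tensorMap, Under.w_assoc]
  map_id x := Under.UnderMorphism.ext (tensorMap_id x)
  map_comp f g := Under.UnderMorphism.ext (tensorMap_comp f g)

/-- The coprojection `b ↦ b ⊗ 1` as a natural transformation. -/
noncomputable def inlTrans : objFunctor A ⟶ tensorFunctor A where
  app x := inlMor R A x
  naturality _ _ f := Under.UnderMorphism.ext (inl_tensorMap f).symm

/-- The coprojection `b ↦ 1 ⊗ b` as a natural transformation. -/
noncomputable def inrTrans : objFunctor A ⟶ tensorFunctor A where
  app x := inrMor R A x
  naturality _ _ f := Under.UnderMorphism.ext (inr_tensorMap f).symm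

lemma structMor_comp_objFunctor_map {x y : Under A.right} (f : x ⟶ y) :
    structMor R A x ≫ (objFunctor A).map f = structMor R A y :=
  Under.UnderMorphism.ext (Under.w f)

variable {A} {J : Type u} [SmallCategory J] {D : J ⥤ Under A.right}

/-- A leg of a cocone on `D ⋙ objFunctor A`, as a ring homomorphism. -/
noncomputable def leg (s : Cocone (D ⋙ objFunctor A)) (j : J) : (D.obj j).right ⟶ s.pt.right :=
  (s.ι.app j).right

lemma map_right_comp_leg (s : Cocone (D ⋙ objFunctor A)) {i j : J} (f : i ⟶ j) :
    (D.map f).right ≫ leg s j = leg s i :=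
  congrArg CommaMorphism.right (s.w f)

variable [IsFiltered J]

lemma hom_comp_leg_eq (s : Cocone (D ⋙ objFunctor A)) (i j : J) :
    (D.obj i).hom ≫ leg s i = (D.obj j).hom ≫ leg s j := by
  have key {i k : J} (f : i ⟶ k) : (D.obj i).hom ≫ leg s i = (D.obj k).hom ≫ leg s k := by
    rw [← map_right_comp_leg s f, Under.w_assoc]
  exact (key (IsFiltered.leftToMax i j)).trans (key (IsFiltered.rightToMax i j)).symm

/-- A cocone of `R`-algebras on a filtered system of `A`-algebras, as a cocone of
`A`-algebras. -/
noncomputable def liftCocone (s : Cocone (D ⋙ objFunctor A)) : Cocone D where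
  pt := Under.mk ((D.obj IsFiltered.nonempty.some).hom ≫ leg s IsFiltered.nonempty.some)
  ι :=
    { app j := Under.homMk (leg s j) (hom_comp_leg_eq s _ _)
      naturality i _ f := Under.UnderMorphism.ext <|
        (map_right_comp_leg s f).trans (Category.comp_id (leg s i)).symm }

lemma right_hom_ext {c : Cocone D} (hc : IsColimit c) {Z : CommRingCat.{u}}
    {f g : c.pt.right ⟶ Z}
    (h : ∀ j, (c.ι.app j).right ≫ f = (c.ι.app j).right ≫ g) : f = g := by
  have hw : c.pt.hom ≫ f = c.pt.hom ≫ g := by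
    have j : J := IsFiltered.nonempty.some
    have hj : (D.obj j).hom ≫ (c.ι.app j).right = c.pt.hom := Under.w (c.ι.app j)
    rw [← hj, Category.assoc, Category.assoc]
    exact congrArg _ (h j)
  let f' : c.pt ⟶ Under.mk (c.pt.hom ≫ f) := Under.homMk f rfl
  let g' : c.pt ⟶ Under.mk (c.pt.hom ≫ f) := Under.homMk g hw.symm
  have : f' = g' := hc.hom_ext fun j => Under.UnderMorphism.ext (h j)
  exact congrArg CommaMorphism.right this

lemma ι_right_comp_desc_right {c : Cocone D} (hc : IsColimit c)
    (s : Cocone (D ⋙ objFunctor A)) (j : J) :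
    (c.ι.app j).right ≫ (hc.desc (liftCocone s)).right = leg s j :=
  congrArg CommaMorphism.right (hc.fac (liftCocone s) j)

/-- Restriction of scalars preserves filtered colimits. -/
noncomputable def isColimitObjFunctor {c : Cocone D} (hc : IsColimit c) :
    IsColimit ((objFunctor A).mapCocone c) where
  desc s := Under.homMk (hc.desc (liftCocone s)).right <| by
    have h₁ : c.pt.hom ≫ (hc.desc (liftCocone s)).right = _ :=
      Under.w (hc.desc (liftCocone s))
    change (A.hom ≫ c.pt.hom) ≫ (hc.desc (liftCocone s)).right = s.pt.hom
    rw [Category.assoc, h₁]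
    exact (Category.assoc _ _ _).symm.trans (Under.w (s.ι.app IsFiltered.nonempty.some))
  fac s j := Under.UnderMorphism.ext (ι_right_comp_desc_right hc s j)
  uniq s m hm := Under.UnderMorphism.ext <| right_hom_ext hc fun j =>
    (congrArg CommaMorphism.right (hm j)).trans (ι_right_comp_desc_right hc s j).symm

/-- A leg of a cocone on `D ⋙ tensorFunctor A`, as a ring homomorphism. -/
noncomputable def tensorLeg (s : Cocone (D ⋙ tensorFunctor A)) (j : J) :
    pushout (D.obj j).hom (D.obj j).hom ⟶ s.pt.right :=
  (s.ι.app j).right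

/-- The map out of `colim B_j` given by the first factors of a cocone on the `B_j ⊗_A B_j`. -/
noncomputable def descLeft {c : Cocone D} (hc : IsColimit c)
    (s : Cocone (D ⋙ tensorFunctor A)) : c.pt.right ⟶ s.pt.right :=
  ((isColimitObjFunctor hc).desc
    ((Cocone.precompose (Functor.whiskerLeft D (inlTrans A))).obj s)).right

/-- The map out of `colim B_j` given by the second factors of a cocone on the `B_j ⊗_A B_j`. -/
noncomputable def descRight {c : Cocone D} (hc : IsColimit c)
    (s : Cocone (D ⋙ tensorFunctor A)) : c.pt.right ⟶ s.pt.right :=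
  ((isColimitObjFunctor hc).desc
    ((Cocone.precompose (Functor.whiskerLeft D (inrTrans A))).obj s)).right

lemma ι_right_comp_descLeft {c : Cocone D} (hc : IsColimit c)
    (s : Cocone (D ⋙ tensorFunctor A)) (j : J) :
    (c.ι.app j).right ≫ descLeft hc s = pushout.inl _ _ ≫ tensorLeg s j :=
  congrArg CommaMorphism.right ((isColimitObjFunctor hc).fac
    ((Cocone.precompose (Functor.whiskerLeft D (inlTrans A))).obj s) j)

lemma ι_right_comp_descRight {c : Cocone D} (hc : IsColimit c)
    (s : Cocone (D ⋙ tensorFunctor A)) (j : J) :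
    (c.ι.app j).right ≫ descRight hc s = pushout.inr _ _ ≫ tensorLeg s j :=
  congrArg CommaMorphism.right ((isColimitObjFunctor hc).fac
    ((Cocone.precompose (Functor.whiskerLeft D (inrTrans A))).obj s) j)

lemma hom_comp_descLeft_eq {c : Cocone D} (hc : IsColimit c)
    (s : Cocone (D ⋙ tensorFunctor A)) :
    c.pt.hom ≫ descLeft hc s = c.pt.hom ≫ descRight hc s := by
  have j : J := IsFiltered.nonempty.some
  have hj : (D.obj j).hom ≫ (c.ι.app j).right = c.pt.hom := Under.w (c.ι.app j)
  rw [← hj]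
  refine (Category.assoc _ _ _).trans (Eq.trans ?_ (Category.assoc _ _ _).symm)
  refine (congrArg _ (ι_right_comp_descLeft hc s j)).trans
    (Eq.trans ?_ (congrArg _ (ι_right_comp_descRight hc s j)).symm)
  exact pushout.condition_assoc _

/-- The map out of `(colim B_j) ⊗_A (colim B_j)` induced by a cocone on the `B_j ⊗_A B_j`. -/
noncomputable def tensorDesc {c : Cocone D} (hc : IsColimit c)
    (s : Cocone (D ⋙ tensorFunctor A)) : pushout c.pt.hom c.pt.hom ⟶ s.pt.right :=
  pushout.desc (descLeft hc s) (descRight hc s) (hom_comp_descLeft_eq hc s)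

lemma tensorMap_comp_tensorDesc {c : Cocone D} (hc : IsColimit c)
    (s : Cocone (D ⋙ tensorFunctor A)) (j : J) :
    tensorMap (c.ι.app j) ≫ tensorDesc hc s = tensorLeg s j := by
  apply pushout.hom_ext
  · rw [← Category.assoc, inl_tensorMap, ← ι_right_comp_descLeft hc, Category.assoc]
    exact congrArg _ (pushout.inl_desc _ _ _)
  · rw [← Category.assoc, inr_tensorMap, ← ι_right_comp_descRight hc, Category.assoc]
    exact congrArg _ (pushout.inr_desc _ _ _)

lemma pushout_hom_ext_of_tensorMap {c : Cocone D} (hc : IsColimit c) {Z : CommRingCat.{u}}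
    {f g : pushout c.pt.hom c.pt.hom ⟶ Z}
    (h : ∀ j, tensorMap (c.ι.app j) ≫ f = tensorMap (c.ι.app j) ≫ g) : f = g := by
  apply pushout.hom_ext
  · refine right_hom_ext hc fun j => ?_
    have hj := congrArg (pushout.inl (D.obj j).hom (D.obj j).hom ≫ ·) (h j)
    simp only [← Category.assoc, inl_tensorMap] at hj
    exact (Category.assoc _ _ _).symm.trans (hj.trans (Category.assoc _ _ _))
  · refine right_hom_ext hc fun j => ?_
    have hj := congrArg (pushout.inr (D.obj j).hom (D.obj j).hom ≫ ·) (h j)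
    simp only [← Category.assoc, inr_tensorMap] at hj
    exact (Category.assoc _ _ _).symm.trans (hj.trans (Category.assoc _ _ _))

/-- The functor `B ↦ B ⊗_A B` preserves filtered colimits. -/
noncomputable def isColimitTensorFunctor {c : Cocone D} (hc : IsColimit c) :
    IsColimit ((tensorFunctor A).mapCocone c) where
  desc s := Under.homMk (tensorDesc hc s) <| by
    change (A.hom ≫ c.pt.hom ≫ pushout.inl c.pt.hom c.pt.hom) ≫ tensorDesc hc s = s.pt.hom
    rw [Category.assoc, Category.assoc, tensorDesc, pushout.inl_desc]
    exact (Category.assoc _ _ _).symm.trans (Under.w ((isColimitObjFunctor hc).desc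
      ((Cocone.precompose (Functor.whiskerLeft D (inlTrans A))).obj s)))
  fac s j := Under.UnderMorphism.ext (tensorMap_comp_tensorDesc hc s j)
  uniq s m hm := Under.UnderMorphism.ext <| pushout_hom_ext_of_tensorMap hc fun j =>
    (congrArg CommaMorphism.right (hm j)).trans (tensorMap_comp_tensorDesc hc s j).symm

end Stmt0

open Stmt0 in
theorem stmt0 (R : CommRingCat.{u}) (F : Under R ⥤ Type u)
    [PreservesFilteredColimits F]
    (A : Under R) (J : Type u) [SmallCategory J] [IsFiltered J]
    (D : J ⥤ Under A.right) (c : Cocone D) (hc : IsColimit c)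
    (hyp : ∀ j : J, IsEqualizerDiagram R F (structMor R A (D.obj j))
      (inlMor R A (D.obj j)) (inrMor R A (D.obj j))) :
    IsEqualizerDiagram R F (structMor R A c.pt) (inlMor R A c.pt) (inrMor R A c.pt) := by
  have hO := isColimitOfPreserves F (isColimitObjFunctor hc)
  have hT := isColimitOfPreserves F (isColimitTensorFunctor hc)
  have comp {X Y Z : Under R} {f : X ⟶ Y} {g : Y ⟶ Z} {h : X ⟶ Z} (w : f ≫ g = h)
      (x : F.obj X) : F.map g (F.map f x) = F.map h x := by
    rw [← w, Functor.map_comp_apply]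
  have hcond : structMor R A c.pt ≫ inlMor R A c.pt = structMor R A c.pt ≫ inrMor R A c.pt :=
    Under.UnderMorphism.ext pushout.condition
  have hstruct (j : J) := comp (structMor_comp_objFunctor_map A (c.ι.app j))
  refine ⟨fun x y hxy => ?_, Set.Subset.antisymm ?_ fun x hx => ?_⟩
  · have j : J := IsFiltered.nonempty.some
    obtain ⟨k, f, hf⟩ := (Types.FilteredColimit.isColimit_eq_iff' hO _ _).1
      ((hstruct j x).trans (hxy.trans (hstruct j y).symm))
    have hk := comp (structMor_comp_objFunctor_map A (D.map f))
    exact (hyp k).1 ((hk x).symm.trans (hf.trans (hk y)))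
  · rintro _ ⟨a, rfl⟩
    exact (comp rfl a).trans (comp hcond.symm a).symm
  · obtain ⟨j, y, rfl⟩ := Types.jointly_surjective_of_isColimit hO x
    have hl {k : Under A.right} (f : D.obj j ⟶ k) :=
      (comp ((inlTrans A).naturality f) y).trans (comp rfl y).symm
    have hr {k : Under A.right} (f : D.obj j ⟶ k) :=
      (comp ((inrTrans A).naturality f) y).trans (comp rfl y).symm
    obtain ⟨k, f, hf⟩ := (Types.FilteredColimit.isColimit_eq_iff' hT _ _).1
      ((hl (c.ι.app j)).symm.trans (Eq.trans hx (hr (c.ι.app j))))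
    have hk : F.map ((objFunctor A).map (D.map f)) y ∈
        Set.range (F.map (structMor R A (D.obj k))) := by
      rw [(hyp k).2]
      exact (hl (D.map f)).trans (hf.trans (hr (D.map f)).symm)
    obtain ⟨a, ha⟩ := hk
    refine ⟨a, (hstruct k a).symm.trans ((congrArg _ ha).trans (comp ?_ y))⟩
    exact ((objFunctor A).map_comp _ _).symm.trans (congrArg _ (c.w f))
end

section
/- Let f : A → B be a homomorphism of commutative rings, let S := {a ∈ A : f(a) is a unit of B}, let C be the localization of A at S with canonical map ℓ : A → C, and let g : C → B be the induced factorization of f. Suppose f = h ∘ ℓ′ is another factorization, where ℓ′ : A → C′ exhibits C′ as the localization of A at some submonoid M of A, and h : C′ → B is conservative. Then there is a unique ring isomorphism φ : C → C′ such that φ ∘ ℓ = ℓ′ and h ∘ φ = g. (Thus every ring homomorphism factors uniquely as a localization followed by a conservative map.) -/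
/-!
STATEMENT 2: Let f : A → B be a homomorphism of commutative rings,
S := {a ∈ A : f(a) is a unit of B}, C := Localization S with canonical map ℓ, and
g : C → B the induced factorization of f.  If f = h ∘ ℓ′ is another factorization with
ℓ′ : A → C′ the localization of A at some submonoid M and h : C′ → B conservative, then
there is a unique ring isomorphism φ : C ≃ C′ with φ ∘ ℓ = ℓ′ and h ∘ φ = g.
-/

universe u

theorem stmt2 {A B C' : Type u} [CommRing A] [CommRing B] [CommRing C']
    (f : A →+* B)
    -- S is the submonoid of elements mapped to units
    (S : Submonoid A) (hS : ∀ a : A, a ∈ S ↔ IsUnit (f a))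
    -- g : Localization S → B is the induced factorization of f
    (g : Localization S →+* B) (hg : g.comp (algebraMap A (Localization S)) = f)
    -- ℓ′ : A → C′ exhibits C′ as the localization of A at a submonoid M
    [Algebra A C'] (M : Submonoid A) [IsLocalization M C']
    -- h : C′ → B is conservative and f = h ∘ ℓ′
    (h : C' →+* B) (hh : h.comp (algebraMap A C') = f)
    (hcons : ∀ c : C', IsUnit (h c) ↔ IsUnit c) :
    ∃! φ : Localization S ≃+* C',
      (φ : Localization S →+* C').comp (algebraMap A (Localization S)) = algebraMap A C' ∧
      h.comp (φ : Localization S →+* C') = g := by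
  have hunit (a : A) : a ∈ S ↔ IsUnit (algebraMap A C' a) := by
    rw [hS, ← hcons, ← RingHom.comp_apply, hh]
  have hMS : M ≤ S := fun a ha => (hunit a).2 (IsLocalization.map_units C' ⟨a, ha⟩)
  have : IsLocalization S C' := IsLocalization.of_le M S hMS fun a ha => (hunit a).1 ha
  have hcomp : ((IsLocalization.algEquiv S (Localization S) C').toRingEquiv :
      Localization S →+* C').comp (algebraMap A (Localization S)) = algebraMap A C' :=
    RingHom.ext (IsLocalization.algEquiv S (Localization S) C').commutes
  refine ⟨(IsLocalization.algEquiv S (Localization S) C').toRingEquiv, ⟨hcomp, ?_⟩, ?_⟩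
  · refine IsLocalization.ringHom_ext S ?_
    rw [RingHom.comp_assoc, hcomp, hh, hg]
  · rintro ψ ⟨hψ, -⟩
    refine RingEquiv.toRingHom_injective (IsLocalization.ringHom_ext S ?_)
    exact hψ.trans hcomp.symm
end

section
/- Let f : A → B be a homomorphism of commutative rings. Let 𝒞_f be the category whose objects are triples (A′, ι, p) with A′ a commutative ring, ι : A → A′ an étale ring homomorphism, and p : A′ → B a ring homomorphism with p ∘ ι = f, and whose morphisms (A′, ι, p) → (A″, ι′, p′) are ring homomorphisms φ : A′ → A″ with φ ∘ ι = ι′ and p′ ∘ φ = p. Then: (i) 𝒞_f is a filtered category; and (ii) if C := colim_{𝒞_f} A′ denotes the colimit of the underlying A-algebras, with induced maps j : A → C and h : C → B satisfying h ∘ j = f, then h is Henselian, i.e. for every factorization h = q ∘ ι″ with ι″ : C → C′ an étale ring homomorphism and q : C′ → B, there exists a ring homomorphism s : C′ → C with s ∘ ι″ = id_C and h ∘ s = q. -/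
/-!
STATEMENT 3: Let f : A → B be a homomorphism of commutative rings and 𝒞_f the category of
factorizations A → A′ → B of f with A → A′ étale.  Then (i) 𝒞_f is filtered, and (ii) if
C is the colimit of the underlying A-algebras, with induced maps j : A → C and h : C → B,
then h is Henselian.
-/

universe u

/-- A ring homomorphism is étale if it makes the target an algebra of finite presentation
which is formally étale. -/
def RingHom.IsEtaleHom {A A' : Type u} [CommRing A] [CommRing A'] (f : A →+* A') : Prop :=
  letI := f.toAlgebra
  Algebra.FormallyEtale A A' ∧ Algebra.FinitePresentation A A'

/-- A ring homomorphism `h : C → B` is Henselian if every factorization `C → C′ → B` of `h`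
with `C → C′` étale admits a section. -/
def RingHom.IsHenselianHom {C B : Type u} [CommRing C] [CommRing B] (h : C →+* B) : Prop :=
  ∀ (C' : Type u) [CommRing C'] (ι : C →+* C') (q : C' →+* B),
    ι.IsEtaleHom → q.comp ι = h →
      ∃ s : C' →+* C, s.comp ι = RingHom.id C ∧ h.comp s = q

/-- The category of factorizations `A → A′ → B` of `f` with `A → A′` étale. -/
structure EtaleFactor {A B : Type u} [CommRing A] [CommRing B] (f : A →+* B) :
    Type (u + 1) where
  carrier : Type u
  [commRing : CommRing carrier]
  ι : A →+* carrier
  p : carrier →+* B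
  etale : ι.IsEtaleHom
  fac : p.comp ι = f

attribute [instance] EtaleFactor.commRing

variable {A B : Type u} [CommRing A] [CommRing B] {f : A →+* B}

instance : CategoryTheory.Category (EtaleFactor f) where
  Hom x y := {φ : x.carrier →+* y.carrier // φ.comp x.ι = y.ι ∧ y.p.comp φ = x.p}
  id x := ⟨RingHom.id _, RingHom.id_comp _, RingHom.comp_id _⟩
  comp {x y z} φ ψ :=
    ⟨ψ.1.comp φ.1,
      by rw [RingHom.comp_assoc, φ.2.1, ψ.2.1],
      by rw [← RingHom.comp_assoc, ψ.2.2, φ.2.2]⟩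
  id_comp φ := Subtype.ext (RingHom.comp_id _)
  comp_id φ := Subtype.ext (RingHom.id_comp _)
  assoc φ ψ χ := Subtype.ext (RingHom.comp_assoc _ _ _).symm

open CategoryTheory Limits

/-- The square with legs `i`, `g` and `i'`, `g'` is a pushout of commutative rings. -/
structure RingHom.IsPushoutSquare {R S R' P : Type u} [CommRing R] [CommRing S] [CommRing R']
    [CommRing P] (i : R →+* S) (g : R →+* R') (i' : R' →+* P) (g' : S →+* P) : Prop where
  comm : i'.comp g = g'.comp i
  exists_lift {T : Type u} [CommRing T] (a : R' →+* T) (b : S →+* T) :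
    a.comp g = b.comp i → ∃ c : P →+* T, c.comp i' = a ∧ c.comp g' = b
  hom_ext {T : Type u} [CommRing T] (c d : P →+* T) :
    c.comp i' = d.comp i' → c.comp g' = d.comp g' → c = d

namespace RingHom.IsPushoutSquare

lemma tensorProduct (R S R' : Type u) [CommRing R] [CommRing S] [CommRing R']
    [Algebra R S] [Algebra R R'] :
    IsPushoutSquare (algebraMap R S) (algebraMap R R') (algebraMap R' (TensorProduct R R' S))
      (Algebra.TensorProduct.includeRight : S →ₐ[R] TensorProduct R R' S).toRingHom where
  comm := by
    ext r
    exact (IsScalarTower.algebraMap_apply R R' (TensorProduct R R' S) r).symm.trans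
      (Algebra.TensorProduct.includeRight.commutes r).symm
  exists_lift {T} _ a b hab := by
    let := (a.comp (algebraMap R R')).toAlgebra
    let a' : R' →ₐ[R] T := { a with commutes' := fun _ ↦ rfl }
    let b' : S →ₐ[R] T := { b with commutes' := fun r ↦ (RingHom.congr_fun hab r).symm }
    refine ⟨(Algebra.TensorProduct.lift a' b' fun _ _ ↦ .all _ _).toRingHom, ?_, ?_⟩
    · ext x
      simp [a', Algebra.TensorProduct.algebraMap_apply]
    · ext x
      simp [b']
  hom_ext _ _ h₁ h₂ := Algebra.TensorProduct.ringHom_ext h₁ h₂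

lemma of_equiv {R S R' P Q : Type u} [CommRing R] [CommRing S] [CommRing R'] [CommRing P]
    [CommRing Q] {i : R →+* S} {g : R →+* R'} {i' : R' →+* P} {g' : S →+* P}
    (h : IsPushoutSquare i g i' g') (e : P ≃+* Q) :
    IsPushoutSquare i g (e.toRingHom.comp i') (e.toRingHom.comp g') where
  comm := by rw [RingHom.comp_assoc, h.comm, RingHom.comp_assoc]
  exists_lift a b hab := by
    obtain ⟨c, rfl, rfl⟩ := h.exists_lift a b hab
    exact ⟨c.comp e.symm.toRingHom, by ext; simp, by ext; simp⟩
  hom_ext c d h₁ h₂ := by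
    rw [← RingHom.cancel_right (f := e.toRingHom) e.surjective]
    exact h.hom_ext _ _ h₁ h₂

end RingHom.IsPushoutSquare

namespace RingHom.IsEtaleHom

lemma iff_etale {R S : Type u} [CommRing R] [CommRing S] {g : R →+* S} :
    g.IsEtaleHom ↔ g.Etale := by
  let := g.toAlgebra
  exact (Algebra.etale_iff R S).symm

lemma id (R : Type u) [CommRing R] : (RingHom.id R).IsEtaleHom :=
  iff_etale.2 (RingHom.Etale.of_bijective Function.bijective_id)

lemma comp {R S T : Type u} [CommRing R] [CommRing S] [CommRing T]
    {g : S →+* T} {k : R →+* S} (hg : g.IsEtaleHom) (hk : k.IsEtaleHom) :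
    (g.comp k).IsEtaleHom :=
  iff_etale.2 (RingHom.Etale.stableUnderComposition _ _ (iff_etale.1 hk) (iff_etale.1 hg))

lemma of_comp {R S T : Type u} [CommRing R] [CommRing S] [CommRing T]
    {g : S →+* T} {k : R →+* S} (hk : k.IsEtaleHom) (hgk : (g.comp k).IsEtaleHom) :
    g.IsEtaleHom := by
  let := k.toAlgebra
  let := g.toAlgebra
  let := (g.comp k).toAlgebra
  have : IsScalarTower R S T := IsScalarTower.of_algebraMap_eq fun _ ↦ rfl
  have : Algebra.Etale R S := iff_etale.1 hk
  have : Algebra.Etale R T := iff_etale.1 hgk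
  exact iff_etale.2 (Algebra.Etale.of_restrictScalars R S T)

/-- Étale homomorphisms admit étale pushouts. -/
lemma exists_pushout {R S R' : Type u} [CommRing R] [CommRing S] [CommRing R']
    {i : R →+* S} (hi : i.IsEtaleHom) (g : R →+* R') :
    ∃ (P : Type u) (_ : CommRing P) (i' : R' →+* P) (g' : S →+* P),
      i'.IsEtaleHom ∧ IsPushoutSquare i g i' g' := by
  let := i.toAlgebra
  let := g.toAlgebra
  have : Algebra.Etale R S := iff_etale.1 hi
  exact ⟨TensorProduct R R' S, inferInstance, algebraMap R' _, _,
    iff_etale.2 (RingHom.etale_algebraMap.2 inferInstance), .tensorProduct R S R'⟩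

/-- An étale homomorphism is a pushout of one between rings of finite type over `ℤ`. -/
lemma exists_descent {S S' : Type u} [CommRing S] [CommRing S'] {i : S →+* S'}
    (hi : i.IsEtaleHom) :
    ∃ (R R' : Type u) (_ : CommRing R) (_ : CommRing R') (_ : Algebra.FiniteType ℤ R)
      (g : R →+* S) (i₀ : R →+* R') (g' : R' →+* S'),
      i₀.IsEtaleHom ∧ IsPushoutSquare i₀ g i g' := by
  let := i.toAlgebra
  have : Algebra.Etale S S' := iff_etale.1 hi
  obtain ⟨R, R', _, _, hR, hR', ⟨e⟩⟩ := Algebra.Etale.exists_subalgebra_fg ℤ S S'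
  have h := (IsPushoutSquare.tensorProduct R R' S).of_equiv e.symm.toRingEquiv
  have he : e.symm.toRingEquiv.toRingHom.comp (algebraMap S (TensorProduct R S R')) = i :=
    e.symm.toAlgHom.comp_algebraMap
  rw [he] at h
  exact ⟨R, R', inferInstance, inferInstance, R.fg_iff_finiteType.1 hR, _, _, _,
    iff_etale.2 (RingHom.etale_algebraMap.2 hR'), h⟩

end RingHom.IsEtaleHom

namespace EtaleFactor

variable (f) in
/-- The trivial factorization `A → A → B`. -/
def trivial : EtaleFactor f where
  carrier := A
  ι := RingHom.id A
  p := f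
  etale := .id A
  fac := RingHom.comp_id f

/-- The structure map, as a morphism from the trivial factorization. -/
def fromTrivial (x : EtaleFactor f) : trivial f ⟶ x :=
  ⟨x.ι, RingHom.comp_id _, x.fac⟩

/-- A factorization of `x.p` through an étale map gives a factorization of `f`. -/
def extend (x : EtaleFactor f) {S : Type u} [CommRing S] (i : x.carrier →+* S) (q : S →+* B)
    (hi : i.IsEtaleHom) (hq : q.comp i = x.p) : EtaleFactor f where
  carrier := S
  ι := i.comp x.ι
  p := q
  etale := hi.comp x.etale
  fac := by rw [← RingHom.comp_assoc, hq, x.fac]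

/-- The morphism from `x` to its extension along an étale map. -/
def toExtend (x : EtaleFactor f) {S : Type u} [CommRing S] (i : x.carrier →+* S) (q : S →+* B)
    (hi : i.IsEtaleHom) (hq : q.comp i = x.p) : x ⟶ x.extend i q hi hq :=
  ⟨i, rfl, hq⟩

lemma exists_cocone_objs (x y : EtaleFactor f) :
    ∃ (z : EtaleFactor f) (_ : x ⟶ z) (_ : y ⟶ z), True := by
  obtain ⟨P, _, i', g', hi', hP⟩ := y.etale.exists_pushout x.ι
  obtain ⟨q, hq₁, hq₂⟩ := hP.exists_lift x.p y.p (x.fac.trans y.fac.symm)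
  exact ⟨x.extend i' q hi' hq₁, x.toExtend i' q hi' hq₁, ⟨g', hP.comm.symm, hq₂⟩, ⟨⟩⟩

lemma exists_cocone_maps {x y : EtaleFactor f} (φ ψ : x ⟶ y) :
    ∃ (z : EtaleFactor f) (χ : y ⟶ z), φ ≫ χ = ψ ≫ χ := by
  obtain ⟨P, _, i', g', hi', hP⟩ := x.etale.exists_pushout x.ι
  obtain ⟨c, hc₁, hc₂⟩ := hP.exists_lift (RingHom.id _) (RingHom.id _) rfl
  obtain ⟨d, hd₁, hd₂⟩ := hP.exists_lift φ.1 ψ.1 (φ.2.1.trans ψ.2.1.symm)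
  have hc : c.IsEtaleHom := hi'.of_comp (hc₁ ▸ .id _)
  obtain ⟨Q, _, e, k, he, hQ⟩ := hc.exists_pushout d
  obtain ⟨q, hq₁, -⟩ := hQ.exists_lift y.p x.p <| by
    apply hP.hom_ext
    · rw [RingHom.comp_assoc, RingHom.comp_assoc, hd₁, hc₁, φ.2.2, RingHom.comp_id]
    · rw [RingHom.comp_assoc, RingHom.comp_assoc, hd₂, hc₂, ψ.2.2, RingHom.comp_id]
  refine ⟨y.extend e q he hq₁, y.toExtend e q he hq₁, Subtype.ext ?_⟩
  change e.comp φ.1 = e.comp ψ.1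
  rw [← hd₁, ← hd₂, ← RingHom.comp_assoc, ← RingHom.comp_assoc, hQ.comm, RingHom.comp_assoc,
    RingHom.comp_assoc, hc₁, hc₂]

instance : IsFiltered (EtaleFactor f) where
  cocone_objs := exists_cocone_objs
  cocone_maps _ _ := exists_cocone_maps
  nonempty := ⟨trivial f⟩

lemma exists_surjective (x : EtaleFactor f) :
    ∃ (n : ℕ) (π : MvPolynomial (Fin n) A →+* x.carrier),
      Function.Surjective π ∧ π.comp MvPolynomial.C = x.ι := by
  let := x.ι.toAlgebra
  have : Algebra.FinitePresentation A x.carrier := x.etale.2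
  obtain ⟨n, π, hπ⟩ := Algebra.FiniteType.iff_quotient_mvPolynomial''.1
    (inferInstance : Algebra.FiniteType A x.carrier)
  exact ⟨n, π.toRingHom, hπ, π.comp_algebraMap⟩

lemma exists_hom_of_ker_le {R : Type u} [CommRing R] {x y : EtaleFactor f} (γ : A →+* R)
    (π : R →+* x.carrier) (ρ : R →+* y.carrier) (hπ : Function.Surjective π)
    (hπγ : π.comp γ = x.ι) (hργ : ρ.comp γ = y.ι)
    (hker : RingHom.ker π ≤ RingHom.ker ρ) (hp : x.p.comp π = y.p.comp ρ) :
    ∃ φ : x ⟶ y, φ.1.comp π = ρ := by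
  have hφ := π.liftOfRightInverse_comp _ (Function.rightInverse_surjInv hπ) ⟨ρ, hker⟩
  refine ⟨⟨_, ?_, ?_⟩, hφ⟩
  · rw [← hπγ, ← RingHom.comp_assoc, hφ, hργ]
  · rw [← RingHom.cancel_right hπ, RingHom.comp_assoc, hφ, hp]

lemma isIsomorphic_of_ker_eq {R : Type u} [CommRing R] {x y : EtaleFactor f} (γ : A →+* R)
    (π : R →+* x.carrier) (ρ : R →+* y.carrier) (hπ : Function.Surjective π)
    (hρ : Function.Surjective ρ) (hπγ : π.comp γ = x.ι) (hργ : ρ.comp γ = y.ι)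
    (hker : RingHom.ker π = RingHom.ker ρ) (hp : x.p.comp π = y.p.comp ρ) :
    IsIsomorphic x y := by
  obtain ⟨φ, hφ⟩ := exists_hom_of_ker_le γ π ρ hπ hπγ hργ hker.le hp
  obtain ⟨ψ, hψ⟩ := exists_hom_of_ker_le γ ρ π hρ hργ hπγ hker.ge hp.symm
  refine ⟨⟨φ, ψ, Subtype.ext ?_, Subtype.ext ?_⟩⟩
  · change ψ.1.comp φ.1 = RingHom.id _
    rw [← RingHom.cancel_right hπ, RingHom.comp_assoc, hφ, hψ, RingHom.id_comp]
  · change φ.1.comp ψ.1 = RingHom.id _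
    rw [← RingHom.cancel_right hρ, RingHom.comp_assoc, hψ, hφ, RingHom.id_comp]

instance : EssentiallySmall.{u} (EtaleFactor f) := by
  refine (essentiallySmall_iff _).2 ⟨?_, inferInstance⟩
  choose n π hπ hπC using exists_surjective (f := f)
  let data (x : EtaleFactor f) :
      Σ n : ℕ, Ideal (MvPolynomial (Fin n) A) × (MvPolynomial (Fin n) A →+* B) :=
    ⟨n x, RingHom.ker (π x), x.p.comp (π x)⟩
  have key (x y : EtaleFactor f) (hxy : data x = data y) : IsIsomorphic x y := by
    have aux (m : ℕ) (hm : m = n y) (ρ : MvPolynomial (Fin m) A →+* x.carrier)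
        (hρ : Function.Surjective ρ) (hρC : ρ.comp MvPolynomial.C = x.ι)
        (h : (⟨m, RingHom.ker ρ, x.p.comp ρ⟩ :
          Σ n : ℕ, Ideal (MvPolynomial (Fin n) A) × (MvPolynomial (Fin n) A →+* B)) = data y) :
        IsIsomorphic x y := by
      subst hm
      simp only [data, Sigma.mk.injEq, heq_eq_eq, true_and, Prod.mk.injEq] at h
      exact isIsomorphic_of_ker_eq MvPolynomial.C ρ (π y) hρ (hπ y) hρC (hπC y) h.1 h.2
    exact aux (n x) (congrArg Sigma.fst hxy) (π x) (hπ x) (hπC x) hxy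
  refine small_of_injective
    (f := fun s : Skeleton (EtaleFactor f) ↦ data ((fromSkeleton _).obj s)) fun s t hst ↦ ?_
  obtain ⟨e⟩ := key _ _ hst
  exact skeleton_skeletal _ ⟨(fromSkeleton _).preimageIso e⟩

variable (f) in
/-- The functor sending a factorization `A → A′ → B` to `A′`. -/
def toCommRingCat : EtaleFactor f ⥤ CommRingCat.{u} where
  obj x := CommRingCat.of x.carrier
  map φ := CommRingCat.ofHom φ.1

instance : PreservesColimit (toCommRingCat f) (CategoryTheory.forget CommRingCat.{u}) := by
  have : IsFiltered (SmallModel.{u} (EtaleFactor f)) := .of_equivalence (equivSmallModel _)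
  have := preservesColimitsOfShape_of_equiv (equivSmallModel.{u} (EtaleFactor f)).symm
    (CategoryTheory.forget CommRingCat.{u})
  infer_instance

end EtaleFactor

lemma ULift.intRingHom_ext {R : Type*} [CommRing R] (g k : ULift.{u} ℤ →+* R) : g = k := by
  rw [← RingHom.cancel_right (f := (ULift.ringEquiv.symm : ℤ ≃+* ULift.{u} ℤ).toRingHom)
    ULift.ringEquiv.symm.surjective]
  exact Subsingleton.elim _ _

/-- A homomorphism from a ring of finite type over `ℤ` to a filtered colimit factors through
a stage of the colimit. -/
lemma CommRingCat.exists_factor_of_finiteType_int {J : Type*} [Category* J] [IsFiltered J]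
    {F : J ⥤ CommRingCat.{u}} [PreservesColimit F (CategoryTheory.forget CommRingCat)]
    {c : Cocone F} (hc : IsColimit c) (S : Type u) [CommRing S] [Algebra.FiniteType ℤ S]
    (g : CommRingCat.of S ⟶ c.pt) :
    ∃ (i : J) (g' : CommRingCat.of S ⟶ F.obj i), g = g' ≫ c.ι.app i := by
  have hfp : Algebra.FinitePresentation ℤ S :=
    Algebra.FinitePresentation.of_finiteType.1 inferInstance
  have hfp' : ((algebraMap ℤ S).comp
      (ULift.ringEquiv : ULift.{u} ℤ ≃+* ℤ).toRingHom).FinitePresentation :=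
    RingHom.FinitePresentation.comp (RingHom.finitePresentation_algebraMap.2 hfp)
      (.of_bijective ULift.ringEquiv.bijective)
  let α : (Functor.const J).obj (CommRingCat.of (ULift.{u} ℤ)) ⟶ F :=
    { app i := CommRingCat.ofHom
        ((algebraMap ℤ (F.obj i)).comp (ULift.ringEquiv : ULift.{u} ℤ ≃+* ℤ).toRingHom)
      naturality _ _ _ := CommRingCat.hom_ext (ULift.intRingHom_ext _ _) }
  obtain ⟨i, g', -, hg'⟩ := RingHom.EssFiniteType.exists_eq_comp_ι_app_of_isColimit
    (CommRingCat.of (ULift.{u} ℤ)) F α (CommRingCat.ofHom _) c hc hfp' g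
    fun _ ↦ CommRingCat.hom_ext (ULift.intRingHom_ext _ _)
  exact ⟨i, g', hg'⟩

theorem stmt3 {A B : Type u} [CommRing A] [CommRing B] (f : A →+* B)
    -- (ii) is stated for any colimit (in A-algebras) of the underlying diagram:
    -- C together with the maps κ, a structure map j : A → C and a map h : C → B
    (C : Type u) [CommRing C]
    (κ : ∀ x : EtaleFactor f, x.carrier →+* C)
    (hκ : ∀ (x y : EtaleFactor f) (φ : x ⟶ y), (κ y).comp φ.1 = κ x)
    (j : A →+* C) (hj : ∀ x : EtaleFactor f, (κ x).comp x.ι = j)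
    (h : C →+* B) (hh : ∀ x : EtaleFactor f, h.comp (κ x) = x.p)
    (hhj : h.comp j = f)
    -- universal property: (C, κ) is the colimit of the underlying A-algebras
    (huniv : ∀ (T : Type u) [CommRing T] (jT : A →+* T)
      (t : ∀ x : EtaleFactor f, x.carrier →+* T),
      (∀ (x y : EtaleFactor f) (φ : x ⟶ y), (t y).comp φ.1 = t x) →
      (∀ x : EtaleFactor f, (t x).comp x.ι = jT) →
      ∃! u : C →+* T, u.comp j = jT ∧ ∀ x : EtaleFactor f, u.comp (κ x) = t x) :
    -- (i) the category of étale factorizations is filtered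
    CategoryTheory.IsFiltered (EtaleFactor f) ∧
    -- (ii) the induced map h : C → B is Henselian
    h.IsHenselianHom := by
  refine ⟨inferInstance, ?_⟩
  intro C' _ ι q hι hq
  have hdesc (s : Cocone (EtaleFactor.toCommRingCat f)) := huniv s.pt
    ((s.ι.app (.trivial f)).hom) (fun x ↦ (s.ι.app x).hom)
    (fun x y φ ↦ congrArg CommRingCat.Hom.hom (s.w φ))
    (fun x ↦ congrArg CommRingCat.Hom.hom (s.w x.fromTrivial))
  let c : Cocone (EtaleFactor.toCommRingCat f) :=
    { pt := CommRingCat.of C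
      ι := { app x := CommRingCat.ofHom (κ x)
             naturality x y φ := CommRingCat.hom_ext (hκ x y φ) } }
  have hc : IsColimit c :=
    { desc s := CommRingCat.ofHom (hdesc s).choose
      fac s x := CommRingCat.hom_ext ((hdesc s).choose_spec.1.2 x)
      uniq s m hm := by
        have hm' (x : EtaleFactor f) : m.hom.comp (κ x) = (s.ι.app x).hom :=
          congrArg CommRingCat.Hom.hom (hm x)
        refine CommRingCat.hom_ext ((hdesc s).choose_spec.2 m.hom ⟨?_, hm'⟩)
        rw [← hm', ← hj (.trivial f)]
        rfl }
  obtain ⟨R, R', _, _, _, g, ι₀, g', hι₀, hC'⟩ := hι.exists_descent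
  obtain ⟨x, γ', hγ'⟩ := CommRingCat.exists_factor_of_finiteType_int hc R (CommRingCat.ofHom g)
  obtain ⟨γ, hγ⟩ : ∃ γ : R →+* x.carrier, g = (κ x).comp γ :=
    ⟨γ'.hom, congrArg CommRingCat.Hom.hom hγ'⟩
  obtain ⟨P, _, i', k, hi', hP⟩ := hι₀.exists_pushout γ
  obtain ⟨p, hp₁, hp₂⟩ := hP.exists_lift x.p (q.comp g') <| by
    rw [← hh, RingHom.comp_assoc, RingHom.comp_assoc, ← hγ, ← hC'.comm, ← hq, RingHom.comp_assoc]
  obtain ⟨t, ht₁, ht₂⟩ : ∃ t : P →+* C, t.comp i' = κ x ∧ h.comp t = p :=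
    ⟨κ (x.extend i' p hi' hp₁), hκ _ _ (x.toExtend i' p hi' hp₁), hh _⟩
  obtain ⟨s, hs₁, hs₂⟩ := hC'.exists_lift (RingHom.id C) (t.comp k) <| by
    rw [RingHom.comp_assoc, ← hP.comm, ← RingHom.comp_assoc, ht₁, hγ, RingHom.id_comp]
  refine ⟨s, hs₁, hC'.hom_ext _ _ ?_ ?_⟩
  · rw [RingHom.comp_assoc, hs₁, RingHom.comp_id, hq]
  · rw [RingHom.comp_assoc, hs₂, ← RingHom.comp_assoc, ht₂, hp₂]
end

section
/- Let R be a commutative ring and let F, G be functors from commutative R-algebras to sets. Call a surjective homomorphism A → B of commutative R-algebras a square-zero extension if its kernel I satisfies I² = 0. Say F is homogeneous if for every square-zero extension A → B and every R-algebra homomorphism C → B, the canonical map F(A ×_B C) → F(A) ×_{F(B)} F(C) is a bijection. Say a natural transformation α : F → G is formally étale if for every square-zero extension A → B the canonical map F(A) → F(B) ×_{G(B)} G(A) is a bijection. Then: (1) if α : F → G is formally étale and G is homogeneous, then F is homogeneous; (2) conversely, if α : F → G is formally étale, α_A : F(A) → G(A) is surjective for every R-algebra A, and F is homogeneous, then G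 is homogeneous. -/
/-!
STATEMENT 8: For functors F, G from commutative R-algebras (encoded as `Under R` for
`R : CommRingCat`) to sets:
(1) if α : F → G is formally étale and G is homogeneous, then F is homogeneous;
(2) if α : F → G is formally étale, objectwise surjective, and F is homogeneous, then G is
homogeneous.
-/

open CategoryTheory CategoryTheory.Limits

universe u

namespace Stmt8

variable {R : CommRingCat.{u}}

/-- A morphism of commutative `R`-algebras is a square-zero extension if the underlying ring
homomorphism is surjective and its kernel `I` satisfies `I² = 0`. -/
def IsSquareZeroExtension {A B : Under R} (π : A ⟶ B) : Prop :=
  Function.Surjective (π.right : A.right → B.right) ∧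
    ∀ x y : A.right, π.right x = 0 → π.right y = 0 → x * y = 0

/-- `F` is homogeneous: for every square-zero extension `π : A → B` and every map
`γ : C → B`, the canonical map `F(A ×_B C) → F(A) ×_{F(B)} F(C)` is a bijection.  The fibre
product `A ×_B C` is encoded as an arbitrary pullback of `π` and `γ`. -/
def Homogeneous (F : Under R ⥤ Type u) : Prop :=
  ∀ (A B C : Under R) (π : A ⟶ B) (γ : C ⟶ B), IsSquareZeroExtension π →
    ∀ (P : Under R) (p₁ : P ⟶ A) (p₂ : P ⟶ C), IsPullback p₁ p₂ π γ →
      Function.Injective (fun x : F.obj P => (F.map p₁ x, F.map p₂ x)) ∧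
      ∀ (a : F.obj A) (c : F.obj C), F.map π a = F.map γ c →
        ∃ x : F.obj P, F.map p₁ x = a ∧ F.map p₂ x = c

/-- `α : F → G` is formally étale: for every square-zero extension `π : A → B` the canonical
map `F(A) → F(B) ×_{G(B)} G(A)` is a bijection. -/
def FormallyEtale {F G : Under R ⥤ Type u} (α : F ⟶ G) : Prop :=
  ∀ (A B : Under R) (π : A ⟶ B), IsSquareZeroExtension π →
    Function.Injective (fun x : F.obj A => (F.map π x, α.app A x)) ∧
    ∀ (b : F.obj B) (a : G.obj A), α.app B b = G.map π a →
      ∃ x : F.obj A, F.map π x = b ∧ α.app A x = a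

end Stmt8

namespace Stmt8

variable {R : CommRingCat.{u}}

theorem IsSquareZeroExtension.of_isPullback {A B C P : Under R} {π : A ⟶ B} {γ : C ⟶ B}
    {p₁ : P ⟶ A} {p₂ : P ⟶ C} (hπ : IsSquareZeroExtension π) (h : IsPullback p₁ p₂ π γ) :
    IsSquareZeroExtension p₂ := by
  have hT := h.map (Under.forget R ⋙ forget CommRingCat)
  have comm (z : P.right) : π.right (p₁.right z) = γ.right (p₂.right z) :=
    ConcreteCategory.congr_hom (congrArg CommaMorphism.right h.w) z
  refine ⟨fun c ↦ ?_, fun x y hx hy ↦ ?_⟩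
  · obtain ⟨a, ha⟩ := hπ.1 (γ.right c)
    obtain ⟨x, -, hx⟩ := Types.exists_of_isPullback hT a c ha
    exact ⟨x, hx⟩
  · refine Types.ext_of_isPullback hT ?_ ?_
    · change p₁.right (x * y) = p₁.right 0
      rw [map_mul, map_zero]
      exact hπ.2 _ _ (by rw [comm, hx, map_zero]) (by rw [comm, hy, map_zero])
    · change p₂.right (x * y) = p₂.right 0
      rw [map_mul, hx, zero_mul, map_zero]

section

variable {F G : Under R ⥤ Type u} {α : F ⟶ G}

theorem FormallyEtale.eq_of_map_eq (hα : FormallyEtale α) {A B : Under R} {π : A ⟶ B}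
    (hπ : IsSquareZeroExtension π) {x y : F.obj A} (h : F.map π x = F.map π y)
    (h' : α.app A x = α.app A y) : x = y :=
  (hα A B π hπ).1 (Prod.ext h h')

theorem Homogeneous.eq_of_map_eq (hF : Homogeneous F) {A B C P : Under R} {π : A ⟶ B}
    {γ : C ⟶ B} {p₁ : P ⟶ A} {p₂ : P ⟶ C} (hπ : IsSquareZeroExtension π)
    (h : IsPullback p₁ p₂ π γ) {x y : F.obj P} (h₁ : F.map p₁ x = F.map p₁ y)
    (h₂ : F.map p₂ x = F.map p₂ y) : x = y :=
  (hF A B C π γ hπ P p₁ p₂ h).1 (Prod.ext h₁ h₂)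

theorem map_map_of_isPullback (F : Under R ⥤ Type u) {A B C P : Under R} {π : A ⟶ B}
    {γ : C ⟶ B} {p₁ : P ⟶ A} {p₂ : P ⟶ C} (h : IsPullback p₁ p₂ π γ) (x : F.obj P) :
    F.map π (F.map p₁ x) = F.map γ (F.map p₂ x) := by
  rw [← Functor.map_comp_apply, ← Functor.map_comp_apply, h.w]

theorem FormallyEtale.homogeneous_source (hα : FormallyEtale α) (hG : Homogeneous G) :
    Homogeneous F := by
  intro A B C π γ hπ P p₁ p₂ h
  have hp₂ := hπ.of_isPullback h
  refine ⟨fun x y hxy ↦ ?_, fun a c hac ↦ ?_⟩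
  · obtain ⟨h₁, h₂⟩ := Prod.ext_iff.mp hxy
    dsimp only at h₁ h₂
    refine hα.eq_of_map_eq hp₂ h₂ (hG.eq_of_map_eq hπ h ?_ ?_)
    · rw [← NatTrans.naturality_apply, h₁, NatTrans.naturality_apply]
    · rw [← NatTrans.naturality_apply, h₂, NatTrans.naturality_apply]
  · obtain ⟨g, hg₁, hg₂⟩ := (hG A B C π γ hπ P p₁ p₂ h).2 (α.app A a) (α.app C c)
      (by rw [← NatTrans.naturality_apply, hac, NatTrans.naturality_apply])
    obtain ⟨x, hx, hxg⟩ := (hα P C p₂ hp₂).2 c g hg₂.symm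
    refine ⟨x, hα.eq_of_map_eq hπ ?_ ?_, hx⟩
    · rw [map_map_of_isPullback F h, hx, hac]
    · rw [NatTrans.naturality_apply, hxg, hg₁]

theorem FormallyEtale.homogeneous_target (hα : FormallyEtale α)
    (hs : ∀ A : Under R, Function.Surjective (α.app A)) (hF : Homogeneous F) :
    Homogeneous G := by
  intro A B C π γ hπ P p₁ p₂ h
  have hp₂ := hπ.of_isPullback h
  refine ⟨fun g g' hgg' ↦ ?_, fun a c hac ↦ ?_⟩
  · obtain ⟨h₁, h₂⟩ := Prod.ext_iff.mp hgg'
    dsimp only at h₁ h₂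
    obtain ⟨x, rfl⟩ := hs P g
    obtain ⟨x', hx', rfl⟩ := (hα P C p₂ hp₂).2 (F.map p₂ x) g'
      (by rw [NatTrans.naturality_apply, h₂])
    refine congrArg (α.app P) (hF.eq_of_map_eq hπ h (hα.eq_of_map_eq hπ ?_ ?_) hx'.symm)
    · rw [map_map_of_isPullback F h, map_map_of_isPullback F h, hx']
    · rw [NatTrans.naturality_apply, NatTrans.naturality_apply, h₁]
  · obtain ⟨c, rfl⟩ := hs C c
    obtain ⟨a, ha, rfl⟩ := (hα A B π hπ).2 (F.map γ c) a
      (by rw [NatTrans.naturality_apply, hac])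
    obtain ⟨x, rfl, rfl⟩ := (hF A B C π γ hπ P p₁ p₂ h).2 a c ha
    exact ⟨α.app P x, (NatTrans.naturality_apply ..).symm, (NatTrans.naturality_apply ..).symm⟩

end

end Stmt8

open Stmt8 in
theorem stmt8 {R : CommRingCat.{u}} (F G : Under R ⥤ Type u) (α : F ⟶ G) :
    -- (1)
    (FormallyEtale α → Homogeneous G → Homogeneous F) ∧
    -- (2)
    (FormallyEtale α → (∀ A : Under R, Function.Surjective (α.app A)) →
      Homogeneous F → Homogeneous G) := by
  exact ⟨FormallyEtale.homogeneous_source, FormallyEtale.homogeneous_target⟩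
end

section
/- Let A → B be a surjective homomorphism of commutative rings whose kernel I satisfies I² = 0 (more generally, Iⁿ = 0 for some n ≥ 1), and let C be a commutative A-algebra. Then C is a finitely generated A-algebra if and only if C ⊗_A B (equivalently, C/IC) is a finitely generated B-algebra. In particular, any lift to C of a finite generating set of the B-algebra C ⊗_A B generates C as an A-algebra. -/
/-!
STATEMENT 9: Let A → B be a surjective ring homomorphism whose kernel I satisfies Iⁿ = 0
for some n ≥ 1, and let C be a commutative A-algebra.  Then C is a finitely generated
A-algebra iff B ⊗_A C is a finitely generated B-algebra; and any lift to C of a finite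
generating set of the B-algebra B ⊗_A C generates C as an A-algebra.
-/

open TensorProduct

universe u

/-- Nakayama's lemma for a nilpotent ideal, without finiteness assumptions. -/
theorem Submodule.eq_top_of_sup_smul_top_eq_top_of_isNilpotent {R M : Type*} [CommRing R]
    [AddCommGroup M] [Module R M] {I : Ideal R} (hI : IsNilpotent I) {N : Submodule R M}
    (h : N ⊔ I • (⊤ : Submodule R M) = ⊤) : N = ⊤ := by
  obtain ⟨n, hn⟩ := hI
  have key (k : ℕ) : N ⊔ I ^ k • (⊤ : Submodule R M) = ⊤ := by
    induction k with
    | zero => simp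
    | succ k ih =>
      rw [eq_top_iff]
      calc ⊤ = N ⊔ I • (N ⊔ I ^ k • (⊤ : Submodule R M)) := by rw [ih, h]
        _ ≤ N ⊔ I ^ (k + 1) • (⊤ : Submodule R M) := by
          rw [Submodule.smul_sup, ← Submodule.mul_smul, ← pow_succ', ← sup_assoc,
            sup_eq_left.mpr (Submodule.smul_le_right (I := I) (N := N))]
  simpa [hn] using key n

/-- If `R → S` is surjective with kernel `I`, then the kernel of `M → S ⊗[R] M` is `I • M`. -/
theorem TensorProduct.mem_ker_smul_top_of_one_tmul_eq_zero {R S M : Type*} [CommRing R]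
    [CommRing S] [Algebra R S] [AddCommGroup M] [Module R M]
    (hsurj : Function.Surjective (algebraMap R S)) {m : M} (hm : (1 : S) ⊗ₜ[R] m = 0) :
    m ∈ RingHom.ker (algebraMap R S) • (⊤ : Submodule R M) := by
  let e : (R ⧸ RingHom.ker (Algebra.ofId R S)) ≃ₐ[R] S :=
    Ideal.quotientKerAlgEquivOfSurjective (f := Algebra.ofId R S) hsurj
  have h := congrArg (LinearMap.rTensor M e.symm.toLinearMap) hm
  rw [LinearMap.rTensor_tmul, map_zero, AlgEquiv.toLinearMap_apply, map_one] at h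
  exact (LinearMap.ker_tensorProductMk M).le (LinearMap.mem_ker.mpr h)

/-- If `A → B` is surjective, then a subset of a `B`-algebra generates the same subalgebra over
`A` as over `B`. -/
theorem Algebra.restrictScalars_adjoin_of_surjective {A B D : Type*} [CommRing A] [CommRing B]
    [CommRing D] [Algebra A B] [Algebra B D] [Algebra A D] [IsScalarTower A B D]
    (hsurj : Function.Surjective (algebraMap A B)) (s : Set D) :
    (Algebra.adjoin B s).restrictScalars A = Algebra.adjoin A s := by
  refine le_antisymm (fun x hx ↦ ?_) ?_
  · rw [Subalgebra.mem_restrictScalars] at hx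
    induction hx using Algebra.adjoin_induction with
    | mem x hx => exact Algebra.subset_adjoin hx
    | algebraMap b =>
      obtain ⟨a, rfl⟩ := hsurj b
      rw [← IsScalarTower.algebraMap_apply]
      exact Subalgebra.algebraMap_mem _ a
    | add x y _ _ hx hy => exact add_mem hx hy
    | mul x y _ _ hx hy => exact mul_mem hx hy
  · exact Algebra.adjoin_le Algebra.subset_adjoin

theorem Algebra.adjoin_eq_top_of_adjoin_includeRight_image_eq_top {A B C : Type*} [CommRing A]
    [CommRing B] [CommRing C] [Algebra A B] [Algebra A C]
    (hsurj : Function.Surjective (algebraMap A B))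
    (hI : IsNilpotent (RingHom.ker (algebraMap A B))) {s : Set C}
    (hs : Algebra.adjoin B
      ((Algebra.TensorProduct.includeRight : C →ₐ[A] B ⊗[A] C) '' s) = ⊤) :
    Algebra.adjoin A s = ⊤ := by
  rw [← Algebra.toSubmodule_eq_top]
  refine Submodule.eq_top_of_sup_smul_top_eq_top_of_isNilpotent hI
    (Submodule.eq_top_iff'.mpr fun c ↦ ?_)
  have hc : (Algebra.TensorProduct.includeRight : C →ₐ[A] B ⊗[A] C) c ∈
      (Algebra.adjoin A s).map Algebra.TensorProduct.includeRight := by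
    rw [AlgHom.map_adjoin, ← Algebra.restrictScalars_adjoin_of_surjective hsurj, hs]
    trivial
  obtain ⟨x, hx, hxc⟩ := hc
  rw [← add_sub_cancel x c]
  refine Submodule.add_mem_sup hx (TensorProduct.mem_ker_smul_top_of_one_tmul_eq_zero hsurj ?_)
  rw [TensorProduct.tmul_sub, sub_eq_zero]
  exact hxc.symm

theorem stmt9 {A B C : Type u} [CommRing A] [CommRing B] [CommRing C]
    [Algebra A B] [Algebra A C]
    (hsurj : Function.Surjective (algebraMap A B))
    (n : ℕ) (hn : 1 ≤ n)
    (hI : (RingHom.ker (algebraMap A B)) ^ n = ⊥) :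
    -- C is finitely generated over A iff C ⊗_A B ≅ B ⊗_A C is finitely generated over B
    (Algebra.FiniteType A C ↔ Algebra.FiniteType B (B ⊗[A] C)) ∧
    -- a lift of a finite generating set is a generating set
    (∀ s : Finset C,
      Algebra.adjoin B
        ((Algebra.TensorProduct.includeRight : C →ₐ[A] B ⊗[A] C) '' (s : Set C)) = ⊤ →
      Algebra.adjoin A (s : Set C) = ⊤) := by
  have hnil : IsNilpotent (RingHom.ker (algebraMap A B)) := ⟨n, hI⟩
  refine ⟨⟨fun _ ↦ inferInstance, fun ⟨t, ht⟩ ↦ ?_⟩, fun s hs ↦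
    Algebra.adjoin_eq_top_of_adjoin_includeRight_image_eq_top hsurj hnil hs⟩
  classical
  have hright := Algebra.TensorProduct.includeRight_surjective (R := A) C hsurj
  refine ⟨t.image (Function.surjInv hright),
    Algebra.adjoin_eq_top_of_adjoin_includeRight_image_eq_top hsurj hnil ?_⟩
  rwa [Finset.coe_image, ← Set.image_comp, (Function.rightInverse_surjInv hright).comp_eq_id,
    Set.image_id]
end

section
/- Let 𝒞 be a category, let (T, η, μ) be a monad on 𝒞 with Eilenberg–Moore category 𝒞^T and forgetful functor U : 𝒞^T → 𝒞, let 𝕀 be a small category, and let B : Ob 𝕀 → Ob 𝒞 be a function. Consider families ω assigning to each morphism f : i → j of 𝕀 a morphism ω_f : T(B(i)) → B(j) of 𝒞 such that: (MC1) ω_{id_i} ∘ η_{B(i)} = id_{B(i)} for every object i; and (MC2) ω_{g∘f} ∘ μ_{B(i)} = ω_g ∘ T(ω_f) for all composable morphisms f : i → j and g : j → k. Then for any such ω: each (B(i), ω_{id_i}) is a T-algebra, each ω_f ∘ η_{B(i)} : B(i) → B(j) is a morphism of T-algebras (B(i), ω_{id_i}) → (B(j), ω_{id_j}), and these assemble into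 a functor D_ω : 𝕀 → 𝒞^T with U(D_ω(i)) = B(i); moreover ω ↦ D_ω is a bijection from the set of families satisfying (MC1) and (MC2) to the set of functors D : 𝕀 → 𝒞^T with U(D(i)) = B(i) for every object i, with inverse sending D to the family ω_f := θ_j ∘ T(U(D(f))), where θ_j is the structure map of the T-algebra D(j). -/
/-!
STATEMENT 10: For a monad (T, η, μ) on a category 𝒞, a small category 𝕀 and a function
B : Ob 𝕀 → Ob 𝒞, Maurer–Cartan families ω (families ω_f : T(B i) ⟶ B j for f : i ⟶ j with
ω_{id} ∘ η = id and ω_{g∘f} ∘ μ = ω_g ∘ T(ω_f)) correspond bijectively to functors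
D : 𝕀 ⥤ 𝒞^T with U(D i) = B i; the inverse sends D to ω_f := θ_j ∘ T(U(D f)).
Moreover each (B i, ω_{id}) is a T-algebra, each ω_f ∘ η is a T-algebra morphism, and
these assemble functorially.
-/

open CategoryTheory

universe v₁ v₂ u₁ u₂

namespace Stmt10

variable {C : Type u₁} [Category.{v₁} C] (T : Monad C)
variable {I : Type u₂} [Category.{v₂} I] (B : I → C)

/-- Families assigning to each morphism `f : i ⟶ j` of `𝕀` a morphism `T(B i) ⟶ B j`. -/
def Fam : Type max u₂ v₁ v₂ :=
  ∀ ⦃i j : I⦄, (i ⟶ j) → ((T : C ⥤ C).obj (B i) ⟶ B j)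

/-- The Maurer–Cartan conditions (MC1) and (MC2) on a family. -/
def IsMCFamily (ω : Fam T B) : Prop :=
  (∀ i : I, T.η.app (B i) ≫ ω (𝟙 i) = 𝟙 (B i)) ∧
  (∀ ⦃i j k : I⦄ (f : i ⟶ j) (g : j ⟶ k),
    T.μ.app (B i) ≫ ω (f ≫ g) = (T : C ⥤ C).map (ω f) ≫ ω g)

/-- The family associated to a functor `D : 𝕀 ⥤ 𝒞^T` with `U(D i) = B i`,
namely `ω_f := θ_j ∘ T(U(D f))` (transported along the object equalities). -/
def assocFam (D : I ⥤ T.Algebra) (hD : ∀ i : I, (D.obj i).A = B i) : Fam T B :=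
  fun i j f =>
    eqToHom (congrArg (T : C ⥤ C).obj (hD i).symm) ≫
      (T : C ⥤ C).map ((D.map f).f) ≫ (D.obj j).a ≫ eqToHom (hD j)

end Stmt10

namespace Stmt10

section

variable {C : Type u₁} [Category.{v₁} C] {T : Monad C}
variable {I : Type u₂} [Category.{v₂} I] {B : I → C}

namespace IsMCFamily

/-- Extending `ω_f ∘ η` along the structure map of its target gives back `ω_f`. -/
theorem map_comp_id {ω : Fam T B} (hω : IsMCFamily T B ω) {i j : I} (f : i ⟶ j) :
    (T : C ⥤ C).map (T.η.app (B i) ≫ ω f) ≫ ω (𝟙 j) = ω f := by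
  rw [Functor.map_comp, Category.assoc, ← hω.2 f (𝟙 j), Category.comp_id]
  exact T.right_unit_assoc (B i) (ω f)

/-- Precomposing `ω_f ∘ η` with the structure map of its source gives back `ω_f`. -/
theorem id_comp_unit {ω : Fam T B} (hω : IsMCFamily T B ω) {i j : I} (f : i ⟶ j) :
    ω (𝟙 i) ≫ T.η.app (B i) ≫ ω f = ω f := by
  have h := T.η.naturality_assoc (ω (𝟙 i)) (ω f)
  rw [Functor.id_map] at h
  rw [h, ← hω.2 (𝟙 i) f, Category.id_comp]
  exact T.left_unit_assoc (B i) (ω f)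

theorem unit_comp {ω : Fam T B} (hω : IsMCFamily T B ω) {i j k : I} (f : i ⟶ j) (g : j ⟶ k) :
    T.η.app (B i) ≫ ω (f ≫ g) = (T.η.app (B i) ≫ ω f) ≫ T.η.app (B j) ≫ ω g := by
  have h := T.η.naturality_assoc (ω f) (ω g)
  rw [Functor.id_map] at h
  rw [Category.assoc, h, ← hω.2 f g]
  exact congrArg (T.η.app (B i) ≫ ·) (T.left_unit_assoc (B i) (ω (f ≫ g))).symm

theorem mul_id {ω : Fam T B} (hω : IsMCFamily T B ω) (i : I) :
    T.μ.app (B i) ≫ ω (𝟙 i) = (T : C ⥤ C).map (ω (𝟙 i)) ≫ ω (𝟙 i) := by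
  simpa only [Category.comp_id] using hω.2 (𝟙 i) (𝟙 i)

/-- The functor `D_ω` associated to a Maurer–Cartan family. -/
def functor {ω : Fam T B} (hω : IsMCFamily T B ω) : I ⥤ T.Algebra where
  obj i := { A := B i, a := ω (𝟙 i), unit := hω.1 i, assoc := hω.mul_id i }
  map {i _} f :=
    { f := T.η.app (B i) ≫ ω f
      h := (hω.map_comp_id f).trans (hω.id_comp_unit f).symm }
  map_id i := Monad.Algebra.Hom.ext (hω.1 i)
  map_comp _ _ := Monad.Algebra.Hom.ext (hω.unit_comp _ _)

theorem assocFam_functor {ω : Fam T B} (hω : IsMCFamily T B ω) :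
    assocFam T B hω.functor (fun _ => rfl) = ω := by
  funext i j f
  refine (Category.id_comp _).trans ?_
  exact (congrArg _ (Category.comp_id _)).trans (hω.map_comp_id f)

end IsMCFamily

theorem isMCFamily_assocFam (D : I ⥤ T.Algebra) (hD : ∀ i, (D.obj i).A = B i) :
    IsMCFamily T B (assocFam T B D hD) := by
  obtain rfl : (fun i => (D.obj i).A) = B := funext hD
  refine ⟨fun i => ?_, fun i j k f g => ?_⟩
  · simp [assocFam, (D.obj i).unit]
  · simp [assocFam, (D.obj i).assoc_assoc]

theorem algebra_a_eq (D : I ⥤ T.Algebra) (hD : ∀ i, (D.obj i).A = B i) (i : I) :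
    (D.obj i).a = eqToHom (congrArg (T : C ⥤ C).obj (hD i)) ≫ assocFam T B D hD (𝟙 i) ≫
      eqToHom (hD i).symm := by
  obtain rfl : (fun i => (D.obj i).A) = B := funext hD
  simp [assocFam]

theorem map_f_eq (D : I ⥤ T.Algebra) (hD : ∀ i, (D.obj i).A = B i) {i j : I} (f : i ⟶ j) :
    (D.map f).f = eqToHom (hD i) ≫ T.η.app (B i) ≫ assocFam T B D hD f ≫
      eqToHom (hD j).symm := by
  obtain rfl : (fun i => (D.obj i).A) = B := funext hD
  simp [assocFam, (D.obj i).unit_assoc]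

theorem algebra_ext {X Y : T.Algebra} (hA : X.A = Y.A)
    (ha : X.a = eqToHom (congrArg (T : C ⥤ C).obj hA) ≫ Y.a ≫ eqToHom hA.symm) : X = Y := by
  obtain ⟨A, a, _, _⟩ := X
  obtain ⟨A', a', _, _⟩ := Y
  obtain rfl : A = A' := hA
  obtain rfl : a = a' := by simpa using ha
  rfl

theorem algebra_eqToHom_f {X Y : T.Algebra} (h : X = Y) :
    (eqToHom h).f = eqToHom (congrArg Monad.Algebra.A h) := by
  subst h
  rfl

theorem assocFam_injective :
    Function.Injective
      (fun D : {D : I ⥤ T.Algebra // ∀ i : I, (D.obj i).A = B i} =>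
        assocFam T B D.1 D.2) := by
  rintro ⟨D, hD⟩ ⟨E, hE⟩ h
  replace h : assocFam T B D hD = assocFam T B E hE := h
  have hobj (i : I) : D.obj i = E.obj i := by
    refine algebra_ext ((hD i).trans (hE i).symm) ?_
    rw [algebra_a_eq D hD, algebra_a_eq E hE, congrFun (congrFun (congrFun h i) i) (𝟙 i)]
    simp
  refine Subtype.ext (CategoryTheory.Functor.ext hobj fun i j f => Monad.Algebra.Hom.ext ?_)
  rw [Monad.Algebra.comp_f, Monad.Algebra.comp_f, algebra_eqToHom_f, algebra_eqToHom_f,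
    map_f_eq D hD, map_f_eq E hE, congrFun (congrFun (congrFun h i) j) f]
  simp

end

end Stmt10

open Stmt10 in
theorem stmt10 {C : Type u₁} [Category.{v₁} C] (T : Monad C)
    {I : Type u₂} [Category.{v₂} I] (B : I → C) :
    -- each (B i, ω_{id i}) is a T-algebra:
    (∀ ω : Fam T B, IsMCFamily T B ω → ∀ i : I,
      T.η.app (B i) ≫ ω (𝟙 i) = 𝟙 (B i) ∧
      T.μ.app (B i) ≫ ω (𝟙 i) = (T : C ⥤ C).map (ω (𝟙 i)) ≫ ω (𝟙 i)) ∧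
    -- each ω_f ∘ η : B i ⟶ B j is a morphism of T-algebras (B i, ω_id) ⟶ (B j, ω_id):
    (∀ ω : Fam T B, IsMCFamily T B ω → ∀ ⦃i j : I⦄ (f : i ⟶ j),
      (T : C ⥤ C).map (T.η.app (B i) ≫ ω f) ≫ ω (𝟙 j) =
        ω (𝟙 i) ≫ (T.η.app (B i) ≫ ω f)) ∧
    -- these data assemble into a functor (identities and composition are respected):
    (∀ ω : Fam T B, IsMCFamily T B ω → ∀ ⦃i j k : I⦄ (f : i ⟶ j) (g : j ⟶ k),
      T.η.app (B i) ≫ ω (f ≫ g) =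
        (T.η.app (B i) ≫ ω f) ≫ (T.η.app (B j) ≫ ω g)) ∧
    -- the assignment D ↦ (f ↦ θ_j ∘ T(U(D f))) is injective on functors lifting B, …
    (Function.Injective
      (fun D : {D : I ⥤ T.Algebra // ∀ i : I, (D.obj i).A = B i} =>
        assocFam T B D.1 D.2)) ∧
    -- … takes values in Maurer–Cartan families, …
    (∀ D : {D : I ⥤ T.Algebra // ∀ i : I, (D.obj i).A = B i},
      IsMCFamily T B (assocFam T B D.1 D.2)) ∧
    -- … and hits every Maurer–Cartan family; hence ω ↦ D_ω is a bijection with the stated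
    -- inverse.
    (∀ ω : Fam T B, IsMCFamily T B ω →
      ∃ D : {D : I ⥤ T.Algebra // ∀ i : I, (D.obj i).A = B i},
        assocFam T B D.1 D.2 = ω) := by
  exact ⟨fun ω hω i => ⟨hω.1 i, hω.mul_id i⟩,
    fun ω hω i j f => (hω.map_comp_id f).trans (hω.id_comp_unit f).symm,
    fun ω hω i j k f g => hω.unit_comp f g,
    assocFam_injective,
    fun D => isMCFamily_assocFam D.1 D.2,
    fun ω hω => ⟨⟨hω.functor, fun _ => rfl⟩, hω.assocFam_functor⟩⟩
end

section
/- Let 𝒞 be a category, (T, η, μ) a monad on 𝒞 with Eilenberg–Moore category 𝒞^T and forgetful functor U, 𝕀 a small category, 𝕁 a subcategory of 𝕀, F : 𝕁 → 𝒞^T a functor, and B : Ob 𝕀 → Ob 𝒞 a function with B(j) = U(F(j)) for every object j of 𝕁. Let ω^F be the family on morphisms of 𝕁 corresponding to F, namely ω^F_f := θ_j ∘ T(U(F(f))) for f : i → j in 𝕁, where θ_j is the structure map of F(j). Then restriction of the correspondence ω ↦ D_ω gives a bijection between: (a) families ω assigning to each morphism f : i → j of 𝕀 a morphism ω_f : T(B(i))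 → B(j) satisfying ω_{id_i} ∘ η_{B(i)} = id_{B(i)} and ω_{g∘f} ∘ μ_{B(i)} = ω_g ∘ T(ω_f), and whose restriction to morphisms of 𝕁 equals ω^F; and (b) functors D : 𝕀 → 𝒞^T with U(D(i)) = B(i) for every object i of 𝕀 and whose restriction to 𝕁 equals F. -/
/-!
STATEMENT 11: Relative version of Statement 10.  Given a monad T on 𝒞, a subcategory
𝕁 ⊆ 𝕀 (encoded as a faithful, injective-on-objects functor ι : 𝕁 ⥤ 𝕀), a functor
F : 𝕁 ⥤ 𝒞^T and B : Ob 𝕀 → Ob 𝒞 extending U∘F, the correspondence D ↦ (f ↦ θ_j ∘ T(U(D f)))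
restricts to a bijection between functors D : 𝕀 ⥤ 𝒞^T with U(D i) = B i and D|_𝕁 = F, and
Maurer–Cartan families ω whose restriction to 𝕁 is the family ω^F associated to F.
-/

open CategoryTheory

universe v₁ v₂ v₃ u₁ u₂ u₃

namespace Stmt11

variable {C : Type u₁} [Category.{v₁} C] (T : Monad C)
variable {I : Type u₂} [Category.{v₂} I] (B : I → C)

/-- Families assigning to each morphism `f : i ⟶ j` of `𝕀` a morphism `T(B i) ⟶ B j`. -/
def Fam : Type max u₂ v₁ v₂ :=
  ∀ ⦃i j : I⦄, (i ⟶ j) → ((T : C ⥤ C).obj (B i) ⟶ B j)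

/-- The Maurer–Cartan conditions (MC1) and (MC2) on a family. -/
def IsMCFamily (ω : Fam T B) : Prop :=
  (∀ i : I, T.η.app (B i) ≫ ω (𝟙 i) = 𝟙 (B i)) ∧
  (∀ ⦃i j k : I⦄ (f : i ⟶ j) (g : j ⟶ k),
    T.μ.app (B i) ≫ ω (f ≫ g) = (T : C ⥤ C).map (ω f) ≫ ω g)

/-- The family associated to a functor `D : 𝕀 ⥤ 𝒞^T` with `U(D i) = B i`,
namely `ω_f := θ_j ∘ T(U(D f))` (transported along the object equalities). -/
def assocFam (D : I ⥤ T.Algebra) (hD : ∀ i : I, (D.obj i).A = B i) : Fam T B :=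
  fun i j f =>
    eqToHom (congrArg (T : C ⥤ C).obj (hD i).symm) ≫
      (T : C ⥤ C).map ((D.map f).f) ≫ (D.obj j).a ≫ eqToHom (hD j)

variable {J : Type u₃} [Category.{v₃} J] (ι : J ⥤ I) (F : J ⥤ T.Algebra)

/-- The restriction of the family `ω` to the subcategory `𝕁` equals the family
`ω^F_f = θ_j ∘ T(U(F f))` associated to `F` (transported along the object equalities
`B(ι j) = U(F j)`). -/
def RestrictsTo (hB : ∀ j : J, B (ι.obj j) = (F.obj j).A) (ω : Fam T B) : Prop :=
  ∀ ⦃j j' : J⦄ (f : j ⟶ j'),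
    ω (ι.map f) =
      eqToHom (congrArg (T : C ⥤ C).obj (hB j)) ≫
        (T : C ⥤ C).map ((F.map f).f) ≫ (F.obj j').a ≫ eqToHom (hB j').symm

end Stmt11

namespace Stmt11

section

variable {C : Type u₁} [Category.{v₁} C] {T : Monad C}

lemma algebra_ext {X Y : T.Algebra} (hA : X.A = Y.A)
    (ha : X.a = eqToHom (congrArg (T : C ⥤ C).obj hA) ≫ Y.a ≫ eqToHom hA.symm) : X = Y := by
  obtain ⟨A, a, _, _⟩ := X
  obtain ⟨A', a', _, _⟩ := Y
  obtain rfl : A = A' := hA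
  obtain rfl : a = a' := by simpa using ha
  rfl

lemma eqToHom_algebra_f {X Y : T.Algebra} (h : X = Y) :
    (eqToHom h).f = eqToHom (congrArg Monad.Algebra.A h) := by
  subst h
  rfl

lemma unit_map_algebra {X Y : T.Algebra} (g : X ⟶ Y) :
    T.η.app X.A ≫ (T : C ⥤ C).map g.f ≫ Y.a = g.f := by
  rw [g.h, Monad.Algebra.unit_assoc]

lemma unit_app_eqToHom {X Y : C} (h : X = Y) :
    T.η.app X ≫ eqToHom (congrArg (T : C ⥤ C).obj h) = eqToHom h ≫ T.η.app Y := by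
  subst h
  simp

/-- A functor to the Eilenberg–Moore category is determined by its associated family. -/
lemma functor_ext_of_family {K : Type u₃} [Category.{v₃} K] {G G' : K ⥤ T.Algebra}
    (hA : ∀ k, (G.obj k).A = (G'.obj k).A)
    (hG : ∀ ⦃k k' : K⦄ (f : k ⟶ k'), (T : C ⥤ C).map (G.map f).f ≫ (G.obj k').a =
      eqToHom (congrArg (T : C ⥤ C).obj (hA k)) ≫
        (T : C ⥤ C).map (G'.map f).f ≫ (G'.obj k').a ≫ eqToHom (hA k').symm) :
    G = G' := by
  refine CategoryTheory.Functor.ext (fun k => algebra_ext (hA k) ?_) fun k k' f => ?_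
  · simpa using hG (𝟙 k)
  · ext
    rw [← unit_map_algebra (G.map f), hG f, ← Category.assoc, unit_app_eqToHom (hA k)]
    simp [eqToHom_algebra_f, Monad.Algebra.unit_assoc]

variable {I : Type u₂} [Category.{v₂} I] {B : I → C}

lemma isMCFamily_assocFam (D : I ⥤ T.Algebra) (hD : ∀ i, (D.obj i).A = B i) :
    IsMCFamily T B (assocFam T B D hD) := by
  obtain rfl : (fun i => (D.obj i).A) = B := funext hD
  refine ⟨fun i => ?_, fun i j k f g => ?_⟩
  · simp [assocFam, Monad.Algebra.unit]
  · simp [assocFam, Monad.Algebra.assoc_assoc]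

lemma IsMCFamily.map_unit_comp {ω : Fam T B} (hω : IsMCFamily T B ω) {i j k : I}
    (f : i ⟶ j) (g : j ⟶ k) :
    (T : C ⥤ C).map (T.η.app (B i) ≫ ω f) ≫ ω g = ω (f ≫ g) := by
  rw [Functor.map_comp, Category.assoc, ← hω.2]
  exact T.right_unit_assoc (B i) (ω (f ≫ g))

lemma IsMCFamily.id_comp_unit {ω : Fam T B} (hω : IsMCFamily T B ω) {i j : I} (f : i ⟶ j) :
    ω (𝟙 i) ≫ T.η.app (B i) ≫ ω f = ω f := by
  have h : ω (𝟙 i) ≫ T.η.app (B i) = T.η.app _ ≫ (T : C ⥤ C).map (ω (𝟙 i)) :=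
    T.η.naturality (ω (𝟙 i))
  rw [reassoc_of% h, ← hω.2]
  simp

/-- The functor `D_ω` determined by a Maurer–Cartan family `ω`. -/
def IsMCFamily.toFunctor {ω : Fam T B} (hω : IsMCFamily T B ω) : I ⥤ T.Algebra where
  obj i :=
    { A := B i
      a := ω (𝟙 i)
      unit := hω.1 i
      assoc := by simpa using hω.2 (𝟙 i) (𝟙 i) }
  map {i j} f :=
    { f := T.η.app (B i) ≫ ω f
      h := by rw [hω.map_unit_comp, hω.id_comp_unit, congrArg (@ω i j) (Category.comp_id f)] }
  map_id i := by
    ext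
    exact hω.1 i
  map_comp {i j k} f g := by
    ext
    have h := T.η.naturality (T.η.app (B i) ≫ ω f)
    rw [Functor.id_map] at h
    change T.η.app (B i) ≫ ω (f ≫ g) = (T.η.app (B i) ≫ ω f) ≫ T.η.app (B j) ≫ ω g
    rw [← hω.map_unit_comp f g, ← Category.assoc (T.η.app (B i) ≫ ω f)]
    exact (Category.assoc _ _ _).symm.trans (congrArg (· ≫ ω g) h.symm)

lemma IsMCFamily.toFunctor_family {ω : Fam T B} (hω : IsMCFamily T B ω) {i j : I} (f : i ⟶ j) :
    (T : C ⥤ C).map (hω.toFunctor.map f).f ≫ (hω.toFunctor.obj j).a = ω f := by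
  exact (hω.map_unit_comp f (𝟙 j)).trans (by simp)

lemma IsMCFamily.assocFam_toFunctor {ω : Fam T B} (hω : IsMCFamily T B ω) :
    assocFam T B hω.toFunctor (fun _ => rfl) = ω := by
  funext i j f
  refine (Category.id_comp _).trans (Eq.trans ?_ (hω.toFunctor_family f))
  exact congrArg _ (Category.comp_id _)

lemma eq_of_assocFam_eq {D D' : I ⥤ T.Algebra} (hD : ∀ i, (D.obj i).A = B i)
    (hD' : ∀ i, (D'.obj i).A = B i) (h : assocFam T B D hD = assocFam T B D' hD') :
    D = D' := by
  obtain rfl : (fun i => (D.obj i).A) = B := funext hD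
  refine functor_ext_of_family (fun k => (hD' k).symm) fun k k' f => ?_
  simpa [assocFam] using congrFun (congrFun (congrFun h k) k') f

end

end Stmt11

open Stmt11 in
theorem stmt11 {C : Type u₁} [Category.{v₁} C] (T : Monad C)
    {I : Type u₂} [Category.{v₂} I] {J : Type u₃} [Category.{v₃} J]
    -- ι : 𝕁 ⥤ 𝕀 realizes 𝕁 as a subcategory of 𝕀
    (ι : J ⥤ I) [ι.Faithful] (hι : Function.Injective ι.obj)
    (F : J ⥤ T.Algebra) (B : I → C)
    (hB : ∀ j : J, B (ι.obj j) = (F.obj j).A) :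
    -- the correspondence D ↦ (f ↦ θ_j ∘ T(U(D f))) …
    -- … sends functors lifting B and restricting to F to MC families restricting to ω^F, …
    (∀ D : {D : I ⥤ T.Algebra // (∀ i : I, (D.obj i).A = B i) ∧ ι ⋙ D = F},
      IsMCFamily T B (assocFam T B D.1 D.2.1) ∧
      RestrictsTo T B ι F hB (assocFam T B D.1 D.2.1)) ∧
    -- … is injective on such functors, …
    (Function.Injective
      (fun D : {D : I ⥤ T.Algebra // (∀ i : I, (D.obj i).A = B i) ∧ ι ⋙ D = F} =>
        assocFam T B D.1 D.2.1)) ∧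
    -- … and hits every MC family restricting to ω^F; hence it is a bijection between (b)
    -- and (a).
    (∀ ω : Fam T B, IsMCFamily T B ω → RestrictsTo T B ι F hB ω →
      ∃ D : {D : I ⥤ T.Algebra // (∀ i : I, (D.obj i).A = B i) ∧ ι ⋙ D = F},
        assocFam T B D.1 D.2.1 = ω) := by
  refine ⟨fun D => ⟨isMCFamily_assocFam D.1 D.2.1, ?_⟩,
    fun D D' h => Subtype.ext (eq_of_assocFam_eq D.2.1 D'.2.1 h), fun ω hω hωF =>
      ⟨⟨hω.toFunctor, fun _ => rfl, ?_⟩, hω.assocFam_toFunctor⟩⟩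
  · obtain ⟨D, hD, rfl⟩ := D
    exact fun _ _ _ => rfl
  · exact functor_ext_of_family hB fun _ _ f =>
      (hω.toFunctor_family (ι.map f)).trans (hωF f)
end

section
/- Let e : L → M be a morphism of differential graded Lie algebras over ℚ (degreewise linear, commuting with the differentials and brackets) which is surjective in every degree, and let K be its kernel, so K^i = ker(e : L^i → M^i). Assume [K, K] = 0, i.e. [x, y] = 0 for all x, y ∈ K. Let ω ∈ mc(M), i.e. ω ∈ M¹ with dω + (1/2)[ω, ω] = 0. Then: (i) for any lift ω̃ ∈ L¹ with e(ω̃) = ω, the map D_ω : K^i → K^{i+1}, a ↦ da + [ω̃, a], is independent of the choice of lift ω̃ and satisfies D_ω ∘ D_ω = 0; (ii) for any such lift, the element u(ω̃) := dω̃ + (1/2)[ω̃, ω̃] lies in K² and satisfies D_ω(u(ω̃)) = 0; (iii) for two lifts ω̃ and ω̃′ of ω, the difference u(ω̃′) − u(ω̃) lies in the image of D_ω : K¹ → K²; and (iv) there exists ω̂ ∈ mc(L) with e(ω̂) = ω if and only if u(ω̃) lies in the image of D_ω : K¹ → K² (for one, equivalently every, lift ω̃). Thus the obstruction to lifting ω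 to mc(L) is a well-defined class in H²(K, D_ω). -/
/-!
STATEMENT 12: Obstruction theory for surjective morphisms of DGLAs over ℚ with
square-zero kernel: for e : L ↠ M with kernel K satisfying [K,K] = 0 and ω ∈ mc(M),
(i) D_ω = d + [ω̃,−] on K is independent of the lift ω̃ and squares to zero;
(ii) u(ω̃) = dω̃ + ½[ω̃,ω̃] ∈ K² is a D_ω-cocycle;
(iii) its class is independent of the lift;
(iv) ω lifts to mc(L) iff u(ω̃) is a D_ω-coboundary.
Thus the obstruction to lifting ω is a well-defined class in H²(K, D_ω).
-/

universe u

/-- A differential graded Lie algebra over ℚ.  The bracket is graded: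
`br h : V i → V j → V k` for a proof `h : i + j = k`. -/
structure DGLA : Type (u + 1) where
  V : ℤ → Type u
  [instAdd : ∀ i, AddCommGroup (V i)]
  [instMod : ∀ i, Module ℚ (V i)]
  d : ∀ i : ℤ, V i →ₗ[ℚ] V (i + 1)
  br : ∀ {i j k : ℤ}, i + j = k → V i →ₗ[ℚ] V j →ₗ[ℚ] V k
  antisymm : ∀ {i j k : ℤ} (h : i + j = k) (h' : j + i = k) (a : V i) (b : V j),
    br h a b + (Int.negOnePow (i * j) : ℤ) • br h' b a = 0
  jacobi : ∀ {i j k n : ℤ} (h : i + j + k = n) (a : V i) (b : V j) (c : V k),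
    (Int.negOnePow (k * i) : ℤ) • br (show i + (j + k) = n by omega) a (br rfl b c) +
    (Int.negOnePow (i * j) : ℤ) • br (show j + (k + i) = n by omega) b (br rfl c a) +
    (Int.negOnePow (j * k) : ℤ) • br (show k + (i + j) = n by omega) c (br rfl a b) = 0
  d_squared : ∀ (i : ℤ) (a : V i), d (i + 1) (d i a) = 0
  leibniz : ∀ {i j k : ℤ} (h : i + j = k) (a : V i) (b : V j),
    d k (br h a b) =
      br (show (i + 1) + j = k + 1 by omega) (d i a) b +
      (Int.negOnePow i : ℤ) • br (show i + (j + 1) = k + 1 by omega) a (d j b)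

attribute [instance] DGLA.instAdd DGLA.instMod

/-- A morphism of DGLAs: a family of ℚ-linear, degree-preserving maps commuting with the
differentials and the brackets. -/
structure DGLAHom (L M : DGLA.{u}) where
  toFun : ∀ i : ℤ, L.V i →ₗ[ℚ] M.V i
  map_d : ∀ (i : ℤ) (a : L.V i), toFun (i + 1) (L.d i a) = M.d i (toFun i a)
  map_br : ∀ {i j k : ℤ} (h : i + j = k) (a : L.V i) (b : L.V j),
    toFun k (L.br h a b) = M.br h (toFun i a) (toFun j b)

/-- The Maurer–Cartan equation `dω + ½[ω,ω] = 0` for `ω ∈ L¹`. -/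
def DGLA.IsMC (L : DGLA.{u}) (ω : L.V 1) : Prop :=
  L.d 1 ω + (2⁻¹ : ℚ) • L.br rfl ω ω = 0

namespace DGLA

/-- The Jacobi identity with arbitrary indices for the degrees of the inner brackets. -/
theorem jacobi_of_eq (L : DGLA.{u}) {i j k p q r n : ℤ} (hp : j + k = p) (hq : k + i = q)
    (hr : i + j = r) (hip : i + p = n) (hjq : j + q = n) (hkr : k + r = n)
    (a : L.V i) (b : L.V j) (c : L.V k) :
    (Int.negOnePow (k * i) : ℤ) • L.br hip a (L.br hp b c) +
    (Int.negOnePow (i * j) : ℤ) • L.br hjq b (L.br hq c a) +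
    (Int.negOnePow (j * k) : ℤ) • L.br hkr c (L.br hr a b) = 0 := by
  subst hp hq hr
  exact L.jacobi (by omega) a b c

/-- The bracket is symmetric on elements of degree one. -/
theorem br_comm_of_degree_one (L : DGLA.{u}) {k : ℤ} (h : 1 + 1 = k) (a b : L.V 1) :
    L.br h a b = L.br h b a := by
  have H := L.antisymm h h a b
  simp only [mul_one, Int.negOnePow_one, Units.val_neg, Units.val_one, neg_smul, one_smul] at H
  exact eq_of_sub_eq_zero (by rw [sub_eq_add_neg]; exact H)

theorem br_one_two (L : DGLA.{u}) {k : ℤ} (h : 1 + (1 + 1) = k) (h' : (1 + 1) + 1 = k)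
    (a : L.V 1) (b : L.V (1 + 1)) : L.br h' b a = -L.br h a b := by
  have H := L.antisymm h' h b a
  have h2 : Int.negOnePow ((1 + 1) * 1) = 1 := Int.negOnePow_even _ (by decide)
  rw [h2, Units.val_one, one_smul] at H
  exact eq_neg_of_add_eq_zero_left H

/-- `[ω, [ω, ω]] = 0` for `ω` of degree one. -/
theorem br_br_self (L : DGLA.{u}) {k : ℤ} (h : 1 + (1 + 1) = k) (ω : L.V 1) :
    L.br h ω (L.br rfl ω ω) = 0 := by
  have H := L.jacobi_of_eq rfl rfl rfl h h h ω ω ω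
  simp only [mul_one, Int.negOnePow_one, Units.val_neg, Units.val_one, neg_smul, one_smul] at H
  have H' : (-3 : ℚ) • L.br h ω (L.br rfl ω ω) = 0 := by
    rw [← H]; module
  exact (smul_eq_zero.mp H').resolve_left (by norm_num)

/-- `[[ω, ω], a] = 2 [ω, [ω, a]]` for `ω` of degree one. -/
theorem br_self_br (L : DGLA.{u}) {i p n : ℤ} (hp : 1 + i = p) (hn : 1 + p = n)
    (hn' : (1 + 1) + i = n) (ω : L.V 1) (a : L.V i) :
    L.br hn' (L.br rfl ω ω) a = (2 : ℚ) • L.br hn ω (L.br hp ω a) := by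
  have hp' : i + 1 = p := by omega
  have J := L.jacobi_of_eq hp hp' rfl hn hn (by omega : i + (1 + 1) = n) ω ω a
  have A := L.antisymm hp' hp a ω
  have B := L.antisymm hn' (by omega) (L.br rfl ω ω) a
  have h2 : Int.negOnePow ((1 + 1) * i) = 1 :=
    Int.negOnePow_even _ ((by decide : Even (1 + 1 : ℤ)).mul_right i)
  rw [h2, Units.val_one, one_smul] at B
  rw [eq_neg_of_add_eq_zero_left A, eq_neg_of_add_eq_zero_right B] at J
  rw [map_neg, map_zsmul] at J
  simp only [mul_one, one_mul, Int.negOnePow_one, Units.val_neg, Units.val_one] at J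
  rcases Int.even_or_odd i with hi | hi
  · rw [Int.negOnePow_even _ hi, Units.val_one] at J
    rw [← sub_eq_zero, ← neg_eq_zero, ← J]
    module
  · rw [Int.negOnePow_odd _ hi, Units.val_neg, Units.val_one] at J
    rw [← sub_eq_zero, ← J]
    module

/-- The curvature `dω + ½[ω,ω]` of an element of degree one. -/
def curv (L : DGLA.{u}) (ω : L.V 1) : L.V (1 + 1) :=
  L.d 1 ω + (2⁻¹ : ℚ) • L.br rfl ω ω

/-- The square of the twisted differential is the bracket with the curvature. -/
theorem twisted_d_twisted_d (L : DGLA.{u}) {i : ℤ} (h : 1 + i = i + 1)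
    (h' : 1 + (i + 1) = (i + 1) + 1) (h'' : (1 + 1) + i = (i + 1) + 1) (ω : L.V 1) (a : L.V i) :
    L.d (i + 1) (L.d i a + L.br h ω a) + L.br h' ω (L.d i a + L.br h ω a) =
      L.br h'' (L.curv ω) a := by
  rw [curv, map_add, map_add, L.d_squared, L.leibniz, map_add, LinearMap.add_apply, map_smul,
    LinearMap.smul_apply, L.br_self_br h h', Int.negOnePow_one, Units.val_neg, Units.val_one]
  module

/-- The Bianchi identity. -/
theorem twisted_d_curv (L : DGLA.{u}) (h : (1 : ℤ) + (1 + 1) = (1 + 1) + 1) (ω : L.V 1) :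
    L.d (1 + 1) (L.curv ω) + L.br h ω (L.curv ω) = 0 := by
  rw [curv, map_add, map_add, map_smul, map_smul, L.d_squared, L.leibniz, br_br_self,
    L.br_one_two h, Int.negOnePow_one, Units.val_neg, Units.val_one]
  module

theorem curv_add (L : DGLA.{u}) (ω a : L.V 1) :
    L.curv (ω + a) =
      L.curv ω + (L.d 1 a + L.br rfl ω a) + (2⁻¹ : ℚ) • L.br rfl a a := by
  simp only [curv, map_add, LinearMap.add_apply]
  rw [L.br_comm_of_degree_one rfl a ω]
  module

end DGLA

theorem DGLAHom.map_curv {L M : DGLA.{u}} (e : DGLAHom L M) (ω : L.V 1) :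
    e.toFun (1 + 1) (L.curv ω) = M.curv (e.toFun 1 ω) := by
  rw [DGLA.curv, DGLA.curv, map_add, map_smul, e.map_d, e.map_br]

theorem stmt12 (L M : DGLA.{u}) (e : DGLAHom L M)
    -- e is surjective in every degree, with kernel K = ker e
    (hsurj : ∀ i : ℤ, Function.Surjective (e.toFun i))
    -- [K, K] = 0
    (hK : ∀ {i j k : ℤ} (h : i + j = k) (x : L.V i) (y : L.V j),
      e.toFun i x = 0 → e.toFun j y = 0 → L.br h x y = 0)
    (ω : M.V 1) (hω : M.IsMC ω) :
    -- (i) D_ω(a) := da + [ω̃, a] on K is independent of the choice of the lift ω̃ …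
    (∀ ω₁ ω₂ : L.V 1, e.toFun 1 ω₁ = ω → e.toFun 1 ω₂ = ω →
      ∀ (i : ℤ) (a : L.V i), e.toFun i a = 0 →
        L.d i a + L.br (show (1 : ℤ) + i = i + 1 by omega) ω₁ a =
          L.d i a + L.br (show (1 : ℤ) + i = i + 1 by omega) ω₂ a) ∧
    -- … it maps K into K, and D_ω ∘ D_ω = 0 on K:
    (∀ ω₁ : L.V 1, e.toFun 1 ω₁ = ω →
      ∀ (i : ℤ) (a : L.V i), e.toFun i a = 0 →
        e.toFun (i + 1) (L.d i a + L.br (show (1 : ℤ) + i = i + 1 by omega) ω₁ a) = 0 ∧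
        L.d (i + 1) (L.d i a + L.br (show (1 : ℤ) + i = i + 1 by omega) ω₁ a) +
          L.br (show (1 : ℤ) + (i + 1) = (i + 1) + 1 by omega) ω₁
            (L.d i a + L.br (show (1 : ℤ) + i = i + 1 by omega) ω₁ a) = 0) ∧
    -- (ii) u(ω̃) := dω̃ + ½[ω̃,ω̃] lies in K² and satisfies D_ω(u(ω̃)) = 0:
    (∀ ω₁ : L.V 1, e.toFun 1 ω₁ = ω →
      e.toFun (1 + 1) (L.d 1 ω₁ + (2⁻¹ : ℚ) • L.br rfl ω₁ ω₁) = 0 ∧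
      L.d (1 + 1) (L.d 1 ω₁ + (2⁻¹ : ℚ) • L.br rfl ω₁ ω₁) +
        L.br (show (1 : ℤ) + (1 + 1) = (1 + 1) + 1 by omega) ω₁
          (L.d 1 ω₁ + (2⁻¹ : ℚ) • L.br rfl ω₁ ω₁) = 0) ∧
    -- (iii) for two lifts the difference u(ω̃′) − u(ω̃) is a D_ω-coboundary:
    (∀ ω₁ ω₂ : L.V 1, e.toFun 1 ω₁ = ω → e.toFun 1 ω₂ = ω →
      ∃ a : L.V 1, e.toFun 1 a = 0 ∧
        (L.d 1 ω₂ + (2⁻¹ : ℚ) • L.br rfl ω₂ ω₂) -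
          (L.d 1 ω₁ + (2⁻¹ : ℚ) • L.br rfl ω₁ ω₁) =
          L.d 1 a + L.br rfl ω₁ a) ∧
    -- (iv) ω lifts to mc(L) iff u(ω̃) is a D_ω-coboundary (for any lift ω̃):
    (∀ ω₁ : L.V 1, e.toFun 1 ω₁ = ω →
      ((∃ ω' : L.V 1, L.IsMC ω' ∧ e.toFun 1 ω' = ω) ↔
        ∃ a : L.V 1, e.toFun 1 a = 0 ∧
          L.d 1 ω₁ + (2⁻¹ : ℚ) • L.br rfl ω₁ ω₁ =
            L.d 1 a + L.br rfl ω₁ a)) := by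
  have hcurv (ω₁ : L.V 1) (h₁ : e.toFun 1 ω₁ = ω) : e.toFun (1 + 1) (L.curv ω₁) = 0 := by
    rw [e.map_curv, h₁]
    exact hω
  have hadd (ω₁ a : L.V 1) (ha : e.toFun 1 a = 0) :
      L.curv (ω₁ + a) = L.curv ω₁ + (L.d 1 a + L.br rfl ω₁ a) := by
    rw [L.curv_add, hK rfl a a ha ha, smul_zero, add_zero]
  refine ⟨fun ω₁ ω₂ h₁ h₂ i a ha => ?_, fun ω₁ h₁ i a ha => ⟨?_, ?_⟩,
    fun ω₁ h₁ => ⟨hcurv ω₁ h₁, L.twisted_d_curv _ ω₁⟩, fun ω₁ ω₂ h₁ h₂ => ?_, fun ω₁ h₁ => ⟨?_, ?_⟩⟩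
  · have H := hK (show (1 : ℤ) + i = i + 1 by omega) (ω₁ - ω₂) a
      (by rw [map_sub, h₁, h₂, sub_self]) ha
    rw [map_sub, LinearMap.sub_apply, sub_eq_zero] at H
    rw [H]
  · rw [map_add, e.map_d, e.map_br, ha, map_zero, map_zero, add_zero]
  · rw [L.twisted_d_twisted_d _ _ (by omega)]
    exact hK _ _ _ (hcurv ω₁ h₁) ha
  · have ha : e.toFun 1 (ω₂ - ω₁) = 0 := by rw [map_sub, h₁, h₂, sub_self]
    refine ⟨ω₂ - ω₁, ha, ?_⟩
    have H := hadd ω₁ (ω₂ - ω₁) ha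
    rw [add_sub_cancel] at H
    exact sub_eq_of_eq_add' H
  · rintro ⟨ω', hmc, h'⟩
    have ha : e.toFun 1 (ω' - ω₁) = 0 := by rw [map_sub, h₁, h', sub_self]
    refine ⟨-(ω' - ω₁), by rw [map_neg, ha, neg_zero], ?_⟩
    have H := hadd ω₁ (ω' - ω₁) ha
    rw [add_sub_cancel] at H
    rw [map_neg, map_neg, ← neg_add]
    exact eq_neg_of_add_eq_zero_left (H.symm.trans hmc)
  · rintro ⟨a, ha, hu⟩
    refine ⟨ω₁ + -a, ?_, by rw [map_add, map_neg, ha, h₁, neg_zero, add_zero]⟩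
    have H := hadd ω₁ (-a) (by rw [map_neg, ha, neg_zero])
    rw [map_neg, map_neg, ← neg_add] at H
    exact H.trans (add_neg_eq_zero.mpr hu)
end
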